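/- arXiv:1910.08933 — 4 statements merged into one kernel-verified Lean document; each statement's English description precedes it below -/
import Mathlib

section
/- Let f be a symmetric probability density on ℝ, continuous and strictly positive outside (-x0, x0) with x0 > 1, such that (1) the integral over |x| ≥ x0 of (-ln f(x)) / (x² ln|x|) dx diverges, and (2) the function x ↦ (-ln f(x)) / ln x is monotone increasing to infinity on [x0, ∞). Then the random variable X with density f satisfies Carleman's condition ∑_{k≥1} (E[X^{2k}])^{-1/(2k)} = ∞, and hence its distribution is uniquely determined by its moments. -/
open Filter Set MeasureTheory

namespace Carl

lemma taylor_bound (g : ℕ → ℝ → ℂ) (hg : ∀ n t, HasDerivAt (g n) (g (n+1) t) t)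
    (M : ℕ → ℝ) (hb : ∀ n t, ‖g n t‖ ≤ M n) (x : ℝ) :
    ∀ (m j : ℕ) (h : ℝ), 0 ≤ h → ‖g j (x + h)‖ ≤
      ∑ i ∈ Finset.range m, ‖g (j + i) x‖ * (h ^ i / (i.factorial : ℝ))
        + M (j + m) * (h ^ m / (m.factorial : ℝ)) := by
  intro m
  induction m with
  | zero => intro j h _; simpa using hb j (x + h)
  | succ m ih =>
    intro j h hh
    have hpow : ∀ (i : ℕ) (y : ℝ), HasDerivAt (fun y : ℝ => y ^ (i+1) / ((i+1).factorial : ℝ))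
        (y ^ i / (i.factorial : ℝ)) y := by
      intro i y
      have := (hasDerivAt_pow (i+1) y).div_const (((i+1).factorial : ℕ) : ℝ)
      suffices e : y ^ i / (i.factorial : ℝ)
          = ((i+1 : ℕ):ℝ) * y ^ (i+1-1) / (((i+1).factorial : ℕ) : ℝ) by rw [e]; exact this
      have h1 : ((i.factorial : ℕ) : ℝ) ≠ 0 := by positivity
      have h2 : ((i : ℝ) + 1) ≠ 0 := by positivity
      rw [Nat.factorial_succ]
      push_cast
      field_simp
    have key := image_norm_le_of_norm_deriv_right_le_deriv_boundary (E := ℂ) (a := 0) (b := h)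
      (f := fun y => g j (x + y)) (f' := fun y => g (j+1) (x + y))
      (B := fun y => ‖g j x‖ + (∑ i ∈ Finset.range m,
          ‖g (j + 1 + i) x‖ * (y ^ (i+1) / ((i+1).factorial : ℝ))
        + M (j + 1 + m) * (y ^ (m+1) / ((m+1).factorial : ℝ))))
      (B' := fun y => ∑ i ∈ Finset.range m, ‖g (j + 1 + i) x‖ * (y ^ i / (i.factorial : ℝ))
        + M (j + 1 + m) * (y ^ m / (m.factorial : ℝ)))
      (fun y _ => (HasDerivAt.comp_const_add x y (hg j (x + y))).continuousAt.continuousWithinAt)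
      (fun y _ => (HasDerivAt.comp_const_add x y (hg j (x + y))).hasDerivWithinAt)
      (by simp)
      (by
        intro y
        refine HasDerivAt.const_add _ (HasDerivAt.add ?_ ((hpow m y).const_mul _))
        exact HasDerivAt.fun_sum fun i _ => (hpow i y).const_mul _)
      (by
        intro y hy
        exact ih (j+1) y hy.1)
    have := key (x := h) ⟨hh, le_rfl⟩
    rw [Finset.sum_range_succ']
    refine this.trans (le_of_eq ?_)
    have e1 : j + (m+1) = j + 1 + m := by ring
    have e3 : ∑ i ∈ Finset.range m, ‖g (j + (i+1)) x‖ * (h ^ (i+1) / ((i+1).factorial : ℝ))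
        = ∑ i ∈ Finset.range m, ‖g (j + 1 + i) x‖ * (h ^ (i+1) / ((i+1).factorial : ℝ)) :=
      Finset.sum_congr rfl fun i _ => by rw [show j + (i+1) = j + 1 + i by ring]
    rw [e1, e3]
    simp only [add_zero, pow_zero, Nat.factorial_zero, Nat.cast_one, div_one, mul_one]
    ring

lemma bang_step (g : ℕ → ℝ → ℂ) (hg : ∀ n t, HasDerivAt (g n) (g (n+1) t) t)
    (M : ℕ → ℝ) (hM : ∀ n, 0 < M n) (hlc : ∀ n, M (n+1) ^ 2 ≤ M n * M (n+2))
    (hb : ∀ n t, ‖g n t‖ ≤ M n) (x h : ℝ) (n : ℕ) (hh : 0 ≤ h)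
    (hh' : h ≤ M n / M (n+1) / Real.exp 1)
    (hx : ∀ j, ‖g j x‖ ≤ Real.exp (-((n:ℝ)+1)) * (Real.exp j * M j)) :
    ∀ j, ‖g j (x+h)‖ ≤ Real.exp (-(n:ℝ)) * (Real.exp j * M j) := by
  intro j
  by_cases hj : n ≤ j
  · refine (hb j _).trans ?_
    rw [← mul_assoc, ← Real.exp_add]
    have : (1:ℝ) ≤ Real.exp (-(n:ℝ) + j) := by
      apply Real.one_le_exp
      have : (n:ℝ) ≤ j := by exact_mod_cast hj
      linarith
    nlinarith [hM j]
  · push Not at hj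
    set r := M (n+1) / M n with hr
    have hr0 : 0 < r := div_pos (hM _) (hM _)
    have hmono : Monotone (fun k => M (k+1) / M k) := by
      apply monotone_nat_of_le_succ
      intro k
      rw [div_le_div_iff₀ (hM _) (hM _)]
      nlinarith [hlc k]
    have hrat : ∀ i, j + i ≤ n + 1 → M (j+i) ≤ M j * r ^ i := by
      intro i
      induction i with
      | zero => intro _; simp
      | succ i ih =>
        intro hi
        have h1 := ih (by omega)
        have h2 : M (j+i+1) / M (j+i) ≤ r := hmono (by omega : j + i ≤ n)
        rw [div_le_iff₀ (hM _)] at h2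
        calc M (j+(i+1)) ≤ r * M (j+i) := h2
          _ ≤ r * (M j * r^i) := by gcongr
          _ = _ := by ring
    obtain ⟨m, hm⟩ : ∃ m, j + m = n + 1 := ⟨n+1-j, by omega⟩
    have ht := taylor_bound g hg M hb x m j h hh
    have hz0 : 0 ≤ Real.exp 1 * h * r := by positivity
    have hz : Real.exp 1 * h * r ≤ 1 := by
      have e : M n / M (n+1) / Real.exp 1 = 1 / (Real.exp 1 * r) := by
        rw [hr]; have := (hM n).ne'; have := (hM (n+1)).ne'; field_simp
      rw [e, le_div_iff₀ (by positivity)] at hh'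
      linarith
    have hterm : ∀ i, j + i ≤ n + 1 → Real.exp (-((n:ℝ)+1)) * (Real.exp ((j+i : ℕ):ℝ) * M (j+i)) * (h^i / (i.factorial:ℝ))
        ≤ Real.exp (-((n:ℝ)+1)) * (Real.exp j * M j) * ((Real.exp 1 * h * r)^i / (i.factorial:ℝ)) := by
      intro i hi
      calc _ ≤ Real.exp (-((n:ℝ)+1)) * (Real.exp ((j+i : ℕ):ℝ) * (M j * r^i)) * (h^i / (i.factorial:ℝ)) := by
            gcongr; exact hrat i hi
        _ = _ := by
            have : Real.exp ((j+i : ℕ):ℝ) = Real.exp j * Real.exp 1 ^ i := by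
              rw [← Real.exp_nat_mul, ← Real.exp_add]; push_cast; ring_nf
            rw [this]; ring
    have hlast : M (j+m) * (h^m / (m.factorial:ℝ)) ≤
        Real.exp (-((n:ℝ)+1)) * (Real.exp j * M j) * ((Real.exp 1 * h * r)^m / (m.factorial:ℝ)) := by
      refine le_trans (le_of_eq ?_) (hterm m hm.le)
      rw [hm, ← mul_assoc (Real.exp _), ← Real.exp_add]
      push_cast
      simp
    calc ‖g j (x+h)‖ ≤ _ := ht
      _ ≤ ∑ i ∈ Finset.range m, Real.exp (-((n:ℝ)+1)) * (Real.exp j * M j) * ((Real.exp 1 * h * r)^i / (i.factorial:ℝ))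
          + Real.exp (-((n:ℝ)+1)) * (Real.exp j * M j) * ((Real.exp 1 * h * r)^m / (m.factorial:ℝ)) := by
        refine add_le_add (Finset.sum_le_sum fun i hi => ?_) hlast
        refine le_trans ?_ (hterm i (by have := Finset.mem_range.1 hi; omega))
        gcongr
        exact hx (j+i)
      _ = Real.exp (-((n:ℝ)+1)) * (Real.exp j * M j) * ∑ i ∈ Finset.range (m+1), ((Real.exp 1 * h * r)^i / (i.factorial:ℝ)) := by
        rw [Finset.sum_range_succ, mul_add, Finset.mul_sum]
      _ ≤ Real.exp (-((n:ℝ)+1)) * (Real.exp j * M j) * Real.exp 1 := by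
        have := (hM j).le
        gcongr
        exact (Real.sum_le_exp_of_nonneg hz0 _).trans (Real.exp_le_exp.2 hz)
      _ = _ := by
        have : Real.exp (-(n:ℝ)) = Real.exp (-((n:ℝ)+1)) * Real.exp 1 := by
          rw [← Real.exp_add]; ring_nf
        rw [this]; ring

lemma bang (g : ℕ → ℝ → ℂ) (hg : ∀ n t, HasDerivAt (g n) (g (n+1) t) t)
    (M : ℕ → ℝ) (hM : ∀ n, 0 < M n) (hlc : ∀ n, M (n+1) ^ 2 ≤ M n * M (n+2))
    (hb : ∀ n t, ‖g n t‖ ≤ M n) (h0 : ∀ n, g n 0 = 0)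
    (hdiv : ¬ Summable (fun n => M n / M (n+1))) (t : ℝ) (ht : 0 ≤ t) : g 0 t = 0 := by
  have iter : ∀ (d n : ℕ) (x : ℝ), 0 ≤ x →
      x ≤ ∑ k ∈ Finset.range d, M (n+k) / M (n+k+1) / Real.exp 1 →
      ∀ j, ‖g j x‖ ≤ Real.exp (-(n:ℝ)) * (Real.exp j * M j) := by
    intro d
    induction d with
    | zero =>
      intro n x hx hx' j
      have : x = 0 := le_antisymm (by simpa using hx') hx
      rw [this, h0]
      have := hM j
      simp; positivity
    | succ d ih =>
      intro n x hx hx' j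
      rw [Finset.sum_range_succ'] at hx'
      set y := max 0 (x - M n / M (n+1) / Real.exp 1) with hy
      have ha : 0 < M n / M (n+1) / Real.exp 1 := by have := hM n; have := hM (n+1); positivity
      have hyx : y ≤ x := max_le hx (by linarith)
      have hyS : y ≤ ∑ k ∈ Finset.range d, M (n+1+k) / M (n+1+k+1) / Real.exp 1 := by
        apply max_le
        · refine Finset.sum_nonneg fun k _ => ?_
          have := hM (n+1+k); have := hM (n+1+k+1); positivity
        · have e3 : ∑ k ∈ Finset.range d, M (n+(k+1)) / M (n+(k+1)+1) / Real.exp 1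
              = ∑ k ∈ Finset.range d, M (n+1+k) / M (n+1+k+1) / Real.exp 1 :=
            Finset.sum_congr rfl fun i _ => by rw [show n + (i+1) = n + 1 + i by ring]
          rw [e3, add_zero] at hx'
          linarith
      have h1 := ih (n+1) y (le_max_left _ _) hyS
      have h2 := bang_step g hg M hM hlc hb y (x - y) n (by linarith)
        (by have := le_max_right 0 (x - M n / M (n+1) / Real.exp 1); linarith)
        (by push_cast at h1; exact h1) j
      simpa using h2
  have hle : ∀ n : ℕ, ‖g 0 t‖ ≤ Real.exp (-(n:ℝ)) * M 0 := by
    intro n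
    have hns : ¬ Summable (fun k => M (n+k) / M (n+k+1) / Real.exp 1) := by
      intro hs
      apply hdiv
      have := hs.mul_right (Real.exp 1)
      rw [← summable_nat_add_iff n]
      refine this.congr fun k => ?_
      rw [div_mul_cancel₀ _ (Real.exp_pos 1).ne', add_comm k n]
    have hnn : ∀ k, 0 ≤ M (n+k) / M (n+k+1) / Real.exp 1 := fun k => by
      have := hM (n+k); have := hM (n+k+1); positivity
    have htop := (not_summable_iff_tendsto_nat_atTop_of_nonneg hnn).1 hns
    obtain ⟨d, hd⟩ := (htop.eventually_ge_atTop t).exists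
    simpa using iter d n t ht hd 0
  have hlim : Tendsto (fun n : ℕ => Real.exp (-(n:ℝ)) * M 0) atTop (nhds 0) := by
    have := (Real.tendsto_exp_neg_atTop_nhds_zero.comp tendsto_natCast_atTop_atTop).mul_const (M 0)
    simpa using this
  have := ge_of_tendsto' hlim hle
  exact norm_le_zero_iff.1 this

lemma carleman_ineq (M : ℕ → ℝ) (hM : ∀ n, 0 < M n) (hM0 : M 0 = 1)
    (hs : Summable (fun n => M n / M (n+1))) :
    Summable (fun n : ℕ => (M (n+1)) ^ (-(1 / ((n:ℝ)+1)))) := by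
  set a : ℕ → ℝ := fun n => M n / M (n+1) with ha
  have ha0 : ∀ n, 0 < a n := fun n => div_pos (hM _) (hM _)
  have hprod : ∀ n, ∏ k ∈ Finset.range n, a k = (M n)⁻¹ := by
    intro n
    induction n with
    | zero => simp [hM0]
    | succ n ih =>
      rw [Finset.prod_range_succ, ih, ha]
      have := (hM n).ne'
      field_simp
  set S : ℕ → ℝ := fun n => ∑ k ∈ Finset.range n, ((k:ℝ)+1) * a k with hS
  have hS0 : ∀ n, 0 ≤ S n := fun n => Finset.sum_nonneg fun k _ => by have := ha0 k; positivity
  have hbound : ∀ n : ℕ, (M (n+1)) ^ (-(1 / ((n:ℝ)+1))) ≤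
      2 * Real.exp 1 * (S (n+1) / (((n:ℝ)+1) * ((n:ℝ)+2))) := by
    intro n
    have hn : (0:ℝ) < (n:ℝ)+1 := by positivity
    have amgm := Real.geom_mean_le_arith_mean_weighted (Finset.range (n+1))
      (fun _ => 1 / ((n:ℝ)+1)) (fun k => ((k:ℝ)+1) * a k) (fun _ _ => by positivity)
      (by simp; field_simp) (fun k _ => by have := ha0 k; positivity)
    rw [Real.finsetProd_rpow _ _ (fun k _ => by have := ha0 k; positivity), Finset.prod_mul_distrib, hprod,
      ← Finset.mul_sum] at amgm
    have hfac : ∏ k ∈ Finset.range (n+1), ((k:ℝ)+1) = ((n+1).factorial : ℝ) := by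
      rw [← Finset.prod_range_add_one_eq_factorial]; push_cast; rfl
    rw [hfac] at amgm
    have hf : ((((n:ℝ)+1) / Real.exp 1) ^ (n+1)) ≤ ((n+1).factorial : ℝ) := by
      have := Real.pow_div_factorial_le_exp (x := (n:ℝ)+1) hn.le (n+1)
      rw [div_le_iff₀ (by positivity)] at this
      rw [div_pow, div_le_iff₀ (by positivity), ← Real.exp_nat_mul]
      push_cast
      rw [mul_one]; linarith
    have hMi : 0 < (M (n+1))⁻¹ := inv_pos.2 (hM _)
    have h1 : ((n:ℝ)+1) / Real.exp 1 * (M (n+1)) ^ (-(1 / ((n:ℝ)+1))) ≤ 1 / ((n:ℝ)+1) * S (n+1) := by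
      refine le_trans (le_of_eq ?_) (le_trans (Real.rpow_le_rpow (by positivity)
        (mul_le_mul_of_nonneg_right hf hMi.le) (by positivity : 0 ≤ 1 / ((n:ℝ)+1))) amgm)
      rw [Real.mul_rpow (by positivity) hMi.le, Real.inv_rpow (hM _).le, ← Real.rpow_neg (hM _).le,
        ← Real.rpow_natCast, ← Real.rpow_mul (by positivity)]
      push_cast
      rw [mul_one_div_cancel hn.ne', Real.rpow_one]
    set b := (M (n+1)) ^ (-(1 / ((n:ℝ)+1))) with hbdef
    have e := Real.exp_pos 1
    have h2 : b ≤ Real.exp 1 * S (n+1) / ((n:ℝ)+1)^2 := by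
      rw [le_div_iff₀ (by positivity)]
      have := mul_le_mul_of_nonneg_left h1 (by positivity : 0 ≤ Real.exp 1 * ((n:ℝ)+1))
      field_simp at this
      linarith
    refine h2.trans ?_
    rw [← mul_div_assoc, div_le_div_iff₀ (by positivity) (by positivity)]
    have : 0 ≤ Real.exp 1 * S (n+1) := mul_nonneg e.le (hS0 _)
    have h3 : ((n:ℝ)+1)*((n:ℝ)+2) ≤ 2 * ((n:ℝ)+1)^2 := by
      have : (0:ℝ) ≤ n := n.cast_nonneg
      nlinarith
    nlinarith [mul_le_mul_of_nonneg_left h3 this]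
  have htel : ∀ N : ℕ, ∑ n ∈ Finset.range N, S (n+1) / (((n:ℝ)+1) * ((n:ℝ)+2)) =
      ∑ k ∈ Finset.range N, a k - S N / ((N:ℝ)+1) := by
    intro N
    induction N with
    | zero => simp [hS]
    | succ N ih =>
      rw [Finset.sum_range_succ, ih, Finset.sum_range_succ]
      have : S (N+1) = S N + ((N:ℝ)+1) * a N := by rw [hS]; simp [Finset.sum_range_succ]
      rw [this]
      push_cast
      have h1 : (N:ℝ)+1 ≠ 0 := by positivity
      have h2 : (N:ℝ)+2 ≠ 0 := by positivity
      have h3 : (N:ℝ)+1+1 ≠ 0 := by positivity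
      field_simp
      ring
  have hsum2 : Summable (fun n : ℕ => S (n+1) / (((n:ℝ)+1) * ((n:ℝ)+2))) := by
    refine summable_of_sum_range_le (c := ∑' k, a k) (fun n => by have := hS0 (n+1); positivity) ?_
    intro N
    rw [htel]
    have h1 := hs.sum_le_tsum (Finset.range N) (fun k _ => (ha0 k).le)
    have h2 : 0 ≤ S N / ((N:ℝ)+1) := by have := hS0 N; positivity
    linarith
  exact Summable.of_nonneg_of_le (fun n => Real.rpow_nonneg (hM _).le _) hbound (hsum2.mul_left _)

lemma logconv (μ : Measure ℝ) (hμ : ∀ k : ℕ, Integrable (fun x => |x| ^ k) μ) (n : ℕ) (s : ℝ) :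
    0 ≤ (∫ x, |x| ^ (n+2) ∂μ) + 2 * s * (∫ x, |x| ^ (n+1) ∂μ) + s ^ 2 * ∫ x, |x| ^ n ∂μ := by
  have h1 : (∫ x, |x| ^ (n+2) ∂μ) + 2 * s * (∫ x, |x| ^ (n+1) ∂μ) + s ^ 2 * ∫ x, |x| ^ n ∂μ
      = ∫ x, |x| ^ n * (|x| + s) ^ 2 ∂μ := by
    rw [← integral_const_mul, ← integral_const_mul, ← integral_add (hμ _) ((hμ _).const_mul _),
      ← integral_add (f := fun x => |x| ^ (n+2) + 2 * s * |x| ^ (n+1))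
        ((hμ _).add ((hμ _).const_mul _)) ((hμ _).const_mul _)]
    refine integral_congr_ae (Eventually.of_forall fun x => ?_)
    simp only
    ring
  rw [h1]
  exact integral_nonneg fun x => by positivity

lemma memLp_id (μ : Measure ℝ) [IsProbabilityMeasure μ]
    (hμ : ∀ k : ℕ, Integrable (fun x => |x| ^ k) μ) (k : ℕ) : MemLp id k μ := by
  rcases Nat.eq_zero_or_pos k with rfl | hk
  · simpa using by fun_prop
  · rw [← integrable_norm_rpow_iff (by fun_prop) (by simpa using hk.ne') (by simp)]
    simpa using hμ k

lemma determinate (μ ν : Measure ℝ) [IsProbabilityMeasure μ] [IsProbabilityMeasure ν]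
    (hμ : ∀ k : ℕ, Integrable (fun x => |x| ^ k) μ)
    (hν : ∀ k : ℕ, Integrable (fun x => |x| ^ k) ν)
    (heq : ∀ k : ℕ, ∫ x, x ^ k ∂μ = ∫ x, x ^ k ∂ν)
    (hpos : ∀ k : ℕ, 0 < ∫ x, |x| ^ k ∂ν)
    (hc : ¬ Summable (fun k : ℕ =>
        (∫ x, x ^ (2 * (k + 1)) ∂ν) ^ (-(1 / (2 * ((k : ℝ) + 1)))))) : μ = ν := by
  set M : ℕ → ℝ := fun n => (∫ x, |x| ^ n ∂μ + ∫ x, |x| ^ n ∂ν) / 2 with hMdef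
  have hM : ∀ n, 0 < M n := by
    intro n
    have h1 := hpos n
    have h2 : 0 ≤ ∫ x, |x| ^ n ∂μ := integral_nonneg fun x => by positivity
    simp only [hMdef]; linarith
  have hM0 : M 0 = 1 := by simp [hMdef]
  have hlc : ∀ n, M (n+1) ^ 2 ≤ M n * M (n+2) := by
    intro n
    have h : ∀ s : ℝ, 0 ≤ M (n+2) + 2 * s * M (n+1) + s ^ 2 * M n := by
      intro s
      have h1 := logconv μ hμ n s
      have h2 := logconv ν hν n s
      simp only [hMdef]; linarith
    have h3 := h (-(M (n+1) / M n))
    have h4 := hM n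
    have h5 : M (n+2) + 2 * (-(M (n+1) / M n)) * M (n+1) + (-(M (n+1) / M n)) ^ 2 * M n
        = (M n * M (n+2) - M (n+1) ^ 2) / M n := by
      field_simp; ring
    rw [h5] at h3
    have := mul_nonneg h3 h4.le
    rw [div_mul_cancel₀ _ h4.ne'] at this
    linarith
  have hdiv : ¬ Summable (fun n => M n / M (n+1)) := by
    intro hs
    apply hc
    have h1 := carleman_ineq M hM hM0 hs
    have h2 := h1.comp_injective (i := fun k : ℕ => 2 * k + 1) (fun a b h => by simpa using h)
    refine h2.congr fun k => ?_
    have h3 : M (2 * k + 1 + 1) = ∫ x, x ^ (2 * (k + 1)) ∂ν := by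
      have e : ∀ x : ℝ, |x| ^ (2 * k + 1 + 1) = x ^ (2 * (k+1)) := fun x => by
        rw [show 2 * k + 1 + 1 = 2 * (k+1) by ring, pow_mul, sq_abs, pow_mul]
      simp only [hMdef, e]
      rw [heq]; ring
    simp only [Function.comp]
    rw [h3]
    congr 3
    push_cast; ring
  set g : ℕ → ℝ → ℂ := fun n t => (iteratedDeriv n (charFun μ) t - iteratedDeriv n (charFun ν) t) / 2
    with hgdef
  have hder : ∀ (ρ : Measure ℝ) [IsProbabilityMeasure ρ] (_ : ∀ k : ℕ, Integrable (fun x => |x| ^ k) ρ)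
      (n : ℕ) (t : ℝ), HasDerivAt (iteratedDeriv n (charFun ρ)) (iteratedDeriv (n+1) (charFun ρ) t) t := by
    intro ρ _ hρ n t
    have hcd : ContDiff ℝ ((n+1 : ℕ) : WithTop ℕ∞) (charFun ρ) := contDiff_charFun (memLp_id ρ hρ (n+1))
    rw [iteratedDeriv_succ]
    refine DifferentiableAt.hasDerivAt ?_
    refine (hcd.differentiable_iteratedDeriv n ?_) t
    exact_mod_cast Nat.lt_succ_self n
  have hnorm : ∀ (ρ : Measure ℝ) [IsProbabilityMeasure ρ] (_ : ∀ k : ℕ, Integrable (fun x => |x| ^ k) ρ)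
      (n : ℕ) (t : ℝ), ‖iteratedDeriv n (charFun ρ) t‖ ≤ ∫ x, |x| ^ n ∂ρ := by
    intro ρ _ hρ n t
    rw [iteratedDeriv_charFun (memLp_id ρ hρ n)]
    simp only [norm_mul, norm_pow, Complex.norm_I, one_pow, one_mul]
    refine (norm_integral_le_integral_norm _).trans (le_of_eq ?_)
    refine integral_congr_ae (Eventually.of_forall fun x => ?_)
    have : ‖Complex.exp (t * x * Complex.I)‖ = 1 := by
      have := Complex.norm_exp_ofReal_mul_I (t * x)
      push_cast at this; exact this
    simp [this]
  have hg : ∀ n t, HasDerivAt (g n) (g (n+1) t) t := fun n t =>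
    ((hder μ hμ n t).sub (hder ν hν n t)).div_const 2
  have hb : ∀ n t, ‖g n t‖ ≤ M n := by
    intro n t
    simp only [hgdef, hMdef, norm_div, Complex.norm_ofNat]
    have h1 := norm_sub_le (iteratedDeriv n (charFun μ) t) (iteratedDeriv n (charFun ν) t)
    have h2 := hnorm μ hμ n t
    have h3 := hnorm ν hν n t
    linarith
  have h0 : ∀ n, g n 0 = 0 := by
    intro n
    simp only [hgdef]
    rw [iteratedDeriv_charFun_zero (memLp_id μ hμ n), iteratedDeriv_charFun_zero (memLp_id ν hν n), heq]
    simp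
  have hfin : ∀ t : ℝ, 0 ≤ t → charFun μ t = charFun ν t := by
    intro t ht
    have := bang g hg M hM hlc hb h0 hdiv t ht
    simp only [hgdef, iteratedDeriv_zero] at this
    have h2 : charFun μ t - charFun ν t = 0 := by simpa using this
    exact sub_eq_zero.1 h2
  apply Measure.ext_of_charFun
  funext t
  rcases le_total 0 t with ht | ht
  · exact hfin t ht
  · have := hfin (-t) (by linarith)
    rw [charFun_neg, charFun_neg] at this
    exact (starRingEnd ℂ).injective this

lemma lint_tail (a : ℝ) (ha : 0 < a) :
    ∫⁻ x in {x : ℝ | a ≤ |x|}, ENNReal.ofReal (1 / x ^ 2) ≤ ENNReal.ofReal (2 * Real.pi / a) := by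
  have hI : Integrable (fun x : ℝ => 2 / a ^ 2 * (1 + (x / a) ^ 2)⁻¹) :=
    (integrable_inv_one_add_sq.comp_div ha.ne').const_mul _
  have hv : ∫ x : ℝ, 2 / a ^ 2 * (1 + (x / a) ^ 2)⁻¹ = 2 * Real.pi / a := by
    rw [integral_const_mul, Measure.integral_comp_div (fun x : ℝ => (1 + x ^ 2)⁻¹) a,
      integral_univ_inv_one_add_sq, abs_of_pos ha, smul_eq_mul]
    field_simp
  calc _ ≤ ∫⁻ x in {x : ℝ | a ≤ |x|}, ENNReal.ofReal (2 / a ^ 2 * (1 + (x / a) ^ 2)⁻¹) := by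
        refine setLIntegral_mono' (measurableSet_le measurable_const measurable_norm) ?_
        intro x hx
        apply ENNReal.ofReal_le_ofReal
        have hx' : a ≤ |x| := hx
        have h2 : a ^ 2 ≤ x ^ 2 := by rw [← sq_abs x]; gcongr
        have h3 : 0 < x ^ 2 := lt_of_lt_of_le (by positivity) h2
        have e : 2 / a ^ 2 * (1 + (x / a) ^ 2)⁻¹ = 2 / (a ^ 2 + x ^ 2) := by
          field_simp
        rw [e, div_le_div_iff₀ h3 (by positivity)]
        linarith
    _ ≤ ∫⁻ x, ENNReal.ofReal (2 / a ^ 2 * (1 + (x / a) ^ 2)⁻¹) := setLIntegral_le_lintegral _ _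
    _ = ENNReal.ofReal (2 * Real.pi / a) := by
        rw [← ofReal_integral_eq_lintegral_ofReal hI (Eventually.of_forall fun x => by positivity), hv]

lemma lint_fin (v : ℝ → ℝ) (x0 : ℝ) (hx0 : 0 < x0) (a : ℕ → ℝ) (ha : ∀ k, 0 < a k)
    (hv : ∀ x, x0 ≤ |x| → ∀ k : ℕ, 2 * (k:ℝ) + 4 ≤ v x → a k ≤ |x|)
    (hs : Summable (fun k => 1 / a k)) :
    ∫⁻ x in {x : ℝ | x0 ≤ |x|}, ENNReal.ofReal (v x / x ^ 2) ≠ ⊤ := by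
  have hms : ∀ b : ℝ, MeasurableSet {x : ℝ | b ≤ |x|} := fun b =>
    measurableSet_le measurable_const measurable_norm
  have hmf : Measurable (fun x : ℝ => ENNReal.ofReal (1 / x ^ 2)) := by fun_prop
  set T : ℕ → ℝ → ENNReal := fun k => Set.indicator {x : ℝ | a k ≤ |x|} (fun x => ENNReal.ofReal (1 / x ^ 2)) with hT
  have hTm : ∀ k, Measurable (T k) := fun k => hmf.indicator (hms _)
  have hpt : ∀ x ∈ {x : ℝ | x0 ≤ |x|}, ENNReal.ofReal (v x / x ^ 2) ≤
      4 * ENNReal.ofReal (1 / x ^ 2) + 2 * ∑' k, T k x := by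
    intro x hx
    have hx2 : 0 < x ^ 2 := by
      have : 0 < |x| := lt_of_lt_of_le hx0 hx
      rw [← sq_abs]; positivity
    set K := ⌈(v x - 4) / 2⌉₊ with hK
    have h1 : v x ≤ 4 + 2 * K := by
      have := Nat.le_ceil ((v x - 4) / 2)
      rw [← hK] at this; linarith
    have h2 : ∀ k ∈ Finset.range K, T k x = ENNReal.ofReal (1 / x ^ 2) := by
      intro k hk
      have := Nat.lt_ceil.1 (Finset.mem_range.1 hk)
      have h3 : a k ≤ |x| := hv x hx k (by linarith)
      simp only [hT]
      rw [Set.indicator_of_mem]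
      exact h3
    have h3 : (K : ENNReal) * ENNReal.ofReal (1 / x ^ 2) ≤ ∑' k, T k x := by
      refine le_trans (le_of_eq ?_) (ENNReal.sum_le_tsum (Finset.range K))
      rw [Finset.sum_congr rfl h2]; simp
    calc ENNReal.ofReal (v x / x ^ 2) ≤ ENNReal.ofReal ((4 + 2 * K) * (1 / x ^ 2)) := by
          apply ENNReal.ofReal_le_ofReal
          rw [mul_one_div]; gcongr
      _ = 4 * ENNReal.ofReal (1 / x ^ 2) + 2 * ((K : ENNReal) * ENNReal.ofReal (1 / x ^ 2)) := by
          rw [ENNReal.ofReal_mul (by positivity), ENNReal.ofReal_add (by positivity) (by positivity),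
            ENNReal.ofReal_mul (by positivity)]
          simp
          ring
      _ ≤ _ := by gcongr
  have hfin1 : ∫⁻ x in {x : ℝ | x0 ≤ |x|}, ENNReal.ofReal (1 / x ^ 2) ≠ ⊤ :=
    ne_top_of_le_ne_top ENNReal.ofReal_ne_top (lint_tail x0 hx0)
  have hfin2 : ∫⁻ x in {x : ℝ | x0 ≤ |x|}, ∑' k, T k x ≠ ⊤ := by
    rw [lintegral_tsum (fun k => (hTm k).aemeasurable)]
    have hs2 : Summable (fun k => 2 * Real.pi / a k) := by
      refine (hs.mul_left (2 * Real.pi)).congr fun k => ?_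
      ring
    refine ne_top_of_le_ne_top hs2.tsum_ofReal_ne_top (ENNReal.tsum_le_tsum fun k => ?_)
    refine le_trans (setLIntegral_le_lintegral _ _) ?_
    simp only [hT]
    rw [lintegral_indicator (hms _)]
    exact lint_tail (a k) (ha k)
  refine ne_top_of_le_ne_top ?_ (setLIntegral_mono' (hms x0) hpt)
  rw [lintegral_add_left (by fun_prop), lintegral_const_mul _ hmf,
    lintegral_const_mul _ (Measurable.tsum hTm)]
  exact ENNReal.add_ne_top.2 ⟨ENNReal.mul_ne_top (by simp) hfin1, ENNReal.mul_ne_top (by simp) hfin2⟩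

end Carl

/-- Theorem 1, Hamburger case: under the divergence condition (1)
and the monotone growth condition (2), the symmetric density f satisfies
Carleman's condition and the associated distribution is moment-determinate. -/
theorem stmt_2 (f : ℝ → ℝ) (x0 : ℝ) (hx0 : 1 < x0)
    (hnn : ∀ x, 0 ≤ f x)
    (hdens : ∫ x, f x = 1)
    (hint : Integrable f)
    (hsymm : ∀ x, f (-x) = f x)
    (hcont : ContinuousOn f {x : ℝ | x0 ≤ |x|})
    (hpos : ∀ x, x0 ≤ |x| → 0 < f x)
    (hmom : ∀ k : ℕ, Integrable (fun x => |x| ^ k * f x))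
    -- condition (1)
    (hK : ∫⁻ x in {x : ℝ | x0 ≤ |x|},
        ENNReal.ofReal (-Real.log (f x) / (x ^ 2 * Real.log |x|)) = ⊤)
    -- condition (2)
    (hu_mono : MonotoneOn (fun x => -Real.log (f x) / Real.log x) (Set.Ici x0))
    (hu_top : Tendsto (fun x => -Real.log (f x) / Real.log x) atTop atTop) :
    -- Carleman's condition (Hamburger case)
    (¬ Summable (fun k : ℕ =>
        (∫ x, x ^ (2 * (k + 1)) * f x) ^ (-(1 / (2 * ((k : ℝ) + 1)))))) ∧
    -- moment determinacy
    (∀ μ : Measure ℝ, IsProbabilityMeasure μ →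
        (∀ k : ℕ, ∫ x, x ^ k ∂μ = ∫ x, x ^ k * f x) →
        μ = MeasureTheory.volume.withDensity (fun x => ENNReal.ofReal (f x))) := by
  have habs : ∀ x : ℝ, x0 ≤ |x| → f |x| = f x := by
    intro x _
    rcases abs_choice x with h | h <;> rw [h]
    exact hsymm x
  have heven : ∀ (k : ℕ) (x : ℝ), x ^ (2 * k) = |x| ^ (2 * k) := fun k x => by
    rw [pow_mul, pow_mul, sq_abs]
  have hmpos : ∀ k : ℕ, 0 < ∫ x, |x| ^ k * f x := by
    intro k
    have h0 : 0 ≤ ∫ x, |x| ^ k * f x := integral_nonneg fun x => mul_nonneg (by positivity) (hnn x)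
    refine lt_of_le_of_ne h0 fun h => ?_
    have h1 := (integral_eq_zero_iff_of_nonneg (fun x => mul_nonneg (by positivity) (hnn x))
      (hmom k)).1 h.symm
    have h2 : ∀ᵐ x : ℝ, x ≠ 0 := by simp [ae_iff]
    have h3 : f =ᵐ[volume] 0 := by
      filter_upwards [h1, h2] with x hx hx0
      have : |x| ^ k ≠ 0 := pow_ne_zero _ (abs_ne_zero.2 hx0)
      simpa [hx0] using hx
    rw [integral_congr_ae h3] at hdens
    simp at hdens
  have hcarl : ¬ Summable (fun k : ℕ =>
        (∫ x, x ^ (2 * (k + 1)) * f x) ^ (-(1 / (2 * ((k : ℝ) + 1))))) := by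
    intro hsum
    set u : ℝ → ℝ := fun x => -Real.log (f x) / Real.log x with hu
    set A : ℕ → Set ℝ := fun k => {x | x0 ≤ x ∧ 2 * (k:ℝ) + 4 ≤ u x} with hA
    have hAne : ∀ k, (A k).Nonempty := fun k =>
      ((eventually_ge_atTop x0).and (hu_top.eventually_ge_atTop (2 * (k:ℝ) + 4))).exists
    have hAbdd : ∀ k, BddBelow (A k) := fun k => ⟨x0, fun x hx => hx.1⟩
    set a : ℕ → ℝ := fun k => sInf (A k) with ha
    have hax0 : ∀ k, x0 ≤ a k := fun k => le_csInf (hAne k) fun x hx => hx.1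
    have ha1 : ∀ k, 1 < a k := fun k => lt_of_lt_of_le hx0 (hax0 k)
    have hgt : ∀ k x, a k < x → 2 * (k:ℝ) + 4 ≤ u x := by
      intro k x hx
      obtain ⟨y, hy, hyx⟩ := exists_lt_of_csInf_lt (hAne k) hx
      exact hy.2.trans (hu_mono hy.1 (hy.1.trans hyx.le) hyx.le)
    set C : ℝ := 1 + 2 * Real.pi with hC
    have hC1 : 1 ≤ C := by have := Real.pi_pos; linarith
    have hmle : ∀ k : ℕ, ∫ x, x ^ (2 * (k + 1)) * f x ≤ (C * a k) ^ (2 * (k+1)) := by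
      intro k
      have hak := ha1 k
      have hpt : ∀ x : ℝ, x ^ (2 * (k+1)) * f x ≤ (a k) ^ (2 * (k+1)) * f x + 2 * (1 + x ^ 2)⁻¹ := by
        intro x
        rw [heven]
        by_cases hx : |x| ≤ a k
        · have h1 : |x| ^ (2 * (k+1)) * f x ≤ (a k) ^ (2 * (k+1)) * f x :=
            mul_le_mul_of_nonneg_right (by gcongr) (hnn x)
          have h2 : 0 ≤ 2 * (1 + x ^ 2)⁻¹ := by positivity
          linarith
        · push Not at hx
          have hx0' : x0 ≤ |x| := (hax0 k).trans hx.le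
          have hx1 : 1 < |x| := hak.trans hx
          have h1 := hgt k |x| hx
          simp only [hu] at h1
          rw [habs x hx0', le_div_iff₀ (Real.log_pos hx1)] at h1
          have h2 : f x ≤ (|x| ^ (2 * k + 4))⁻¹ := by
            rw [← Real.exp_log (hpos x hx0'), ← Real.exp_log (inv_pos.2 (by positivity : 0 < |x| ^ (2 * k + 4)))]
            apply Real.exp_le_exp.2
            rw [Real.log_inv, Real.log_pow]
            push_cast
            linarith
          have hp : 0 < |x| := by linarith
          have h3 : |x| ^ (2 * (k+1)) * f x ≤ (|x| ^ 2)⁻¹ := by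
            calc _ ≤ |x| ^ (2 * (k+1)) * (|x| ^ (2 * k + 4))⁻¹ := by gcongr
              _ = (|x| ^ 2)⁻¹ := by
                rw [show 2 * k + 4 = 2 * (k+1) + 2 by ring, pow_add]
                field_simp
          have h4 : (|x| ^ 2)⁻¹ ≤ 2 * (1 + x ^ 2)⁻¹ := by
            rw [← sq_abs x, ← div_eq_mul_inv, inv_eq_one_div, div_le_div_iff₀ (by positivity) (by positivity)]
            nlinarith
          have h5 : 0 ≤ (a k) ^ (2 * (k+1)) * f x := mul_nonneg (by positivity) (hnn x)
          linarith
      have hI1 : Integrable (fun x => x ^ (2 * (k+1)) * f x) := by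
        simpa only [← heven] using hmom (2 * (k+1))
      have hI2 : Integrable (fun x => (a k) ^ (2 * (k+1)) * f x) := hint.const_mul _
      have hI3 : Integrable (fun x : ℝ => 2 * (1 + x ^ 2)⁻¹) := integrable_inv_one_add_sq.const_mul _
      have h1 := integral_mono hI1 (hI2.add hI3) hpt
      simp only [Pi.add_apply] at h1
      rw [integral_add hI2 hI3, integral_const_mul, integral_const_mul, hdens,
        integral_univ_inv_one_add_sq] at h1
      have h2 : 1 ≤ (a k) ^ (2 * (k+1)) := one_le_pow₀ hak.le
      have h3 : C ≤ C ^ (2 * (k+1)) := le_self_pow₀ hC1 (by omega)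
      have hpi := Real.pi_pos
      calc _ ≤ _ := h1
        _ ≤ C * (a k) ^ (2 * (k+1)) := by rw [hC]; nlinarith
        _ ≤ C ^ (2 * (k+1)) * (a k) ^ (2 * (k+1)) := by gcongr
        _ = _ := by rw [mul_pow]
    have hterm : ∀ k : ℕ, 1 / a k ≤
        C * (∫ x, x ^ (2 * (k + 1)) * f x) ^ (-(1 / (2 * ((k : ℝ) + 1)))) := by
      intro k
      have hak := ha1 k
      have hm : 0 < ∫ x, x ^ (2 * (k + 1)) * f x := by
        simpa only [← heven] using hmpos (2 * (k+1))
      have hCa : 0 < C * a k := by positivity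
      have h1 := Real.rpow_le_rpow_of_nonpos hm (hmle k)
        (by have : 0 ≤ 1 / (2 * ((k : ℝ) + 1)) := by positivity
            linarith : -(1 / (2 * ((k : ℝ) + 1))) ≤ 0)
      have h2 : ((C * a k) ^ (2 * (k+1))) ^ (-(1 / (2 * ((k : ℝ) + 1)))) = (C * a k)⁻¹ := by
        rw [← Real.rpow_natCast, ← Real.rpow_mul hCa.le]
        push_cast
        have : (2 * ((k:ℝ) + 1)) * (-(1 / (2 * ((k : ℝ) + 1)))) = -1 := by
          have : (2 * ((k:ℝ) + 1)) ≠ 0 := by positivity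
          field_simp
        rw [this, Real.rpow_neg_one]
      rw [h2] at h1
      calc 1 / a k = C * (C * a k)⁻¹ := by field_simp
        _ ≤ _ := by gcongr
    have hs1 : Summable (fun k => 1 / a k) :=
      Summable.of_nonneg_of_le (fun k => by have := ha1 k; positivity) hterm (hsum.mul_left C)
    refine Carl.lint_fin (fun x => -Real.log (f x) / Real.log |x|) x0 (by linarith) a
      (fun k => by linarith [ha1 k]) ?_ hs1 ?_
    · intro x hx k hk
      refine csInf_le (hAbdd k) ⟨hx, ?_⟩
      simp only [hu]
      rw [habs x hx]
      exact hk
    · rw [← hK]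
      refine lintegral_congr fun x => ?_
      rw [div_div, mul_comm (Real.log |x|)]
  refine ⟨hcarl, ?_⟩
  intro μ hμp hmu
  set ν : Measure ℝ := MeasureTheory.volume.withDensity (fun x => ENNReal.ofReal (f x)) with hν
  have hfm : AEMeasurable (fun x => ENNReal.ofReal (f x)) volume := hint.aemeasurable.ennreal_ofReal
  have hlt : ∀ᵐ x : ℝ, ENNReal.ofReal (f x) < ⊤ := Eventually.of_forall fun x => ENNReal.ofReal_lt_top
  have hνint : ∀ g : ℝ → ℝ, ∫ x, g x ∂ν = ∫ x, g x * f x := by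
    intro g
    rw [hν, integral_withDensity_eq_integral_toReal_smul₀ hfm hlt]
    refine integral_congr_ae (Eventually.of_forall fun x => ?_)
    simp only [ENNReal.toReal_ofReal (hnn x), smul_eq_mul]
    ring
  have hνmom : ∀ k : ℕ, Integrable (fun x => |x| ^ k) ν := by
    intro k
    rw [hν, integrable_withDensity_iff_integrable_smul₀' hfm hlt]
    refine (hmom k).congr (Eventually.of_forall fun x => ?_)
    simp only [ENNReal.toReal_ofReal (hnn x), smul_eq_mul]
    ring
  have : IsProbabilityMeasure ν := by
    constructor
    rw [hν, withDensity_apply _ MeasurableSet.univ, Measure.restrict_univ,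
      ← ofReal_integral_eq_lintegral_ofReal hint (Eventually.of_forall hnn), hdens]
    simp
  have hμeven : ∀ k : ℕ, Integrable (fun x : ℝ => |x| ^ (2 * k)) μ := by
    intro k
    have h1 : ∫ x, x ^ (2 * k) ∂μ ≠ 0 := by
      rw [hmu]
      simpa only [← heven] using (hmpos (2 * k)).ne'
    have := Integrable.of_integral_ne_zero h1
    simpa only [← heven] using this
  have hμmom : ∀ k : ℕ, Integrable (fun x => |x| ^ k) μ := by
    intro k
    refine Integrable.mono' ((integrable_const (1:ℝ)).add (hμeven k)) (by fun_prop)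
      (Eventually.of_forall fun x => ?_)
    simp only [Pi.add_apply, norm_pow, norm_abs_eq_norm, Real.norm_eq_abs]
    rw [mul_comm, pow_mul]
    nlinarith [sq_nonneg (|x| ^ k - 1), sq_nonneg (|x| ^ k)]
  refine Carl.determinate μ ν hμmom hνmom (fun k => ?_) (fun k => ?_) ?_
  · rw [hmu, hνint]
  · rw [hνint]; exact hmpos k
  · simpa only [hνint] using hcarl
end

section
/- Let g be a probability density on [0, ∞), continuous and strictly positive on [a, ∞) for some a > 1, such that (3) ∫_a^∞ (-ln g(x²)) / (x² ln x) dx = ∞ and (4) x ↦ (-ln g(x)) / ln x is monotone increasing to infinity on [a, ∞). Then the random variable Y with density g satisfies the Stieltjes Carleman condition ∑_{k≥1} (E[Y^k])^{-1/(2k)} = ∞, and hence Y is moment-determinate on [0, ∞). -/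
open Filter Set MeasureTheory

theorem bang_step (f : ℝ → ℂ) (M r : ℕ → ℝ) (hf : ContDiff ℝ (⊤ : ℕ∞) f)
    (hM : ∀ n, 0 < M n) (hr : ∀ n, M (n + 1) = r n * M n) (hmono : Monotone r)
    (hr0 : ∀ n, 0 < r n)
    (hb : ∀ n t, ‖iteratedDeriv n f t‖ ≤ M n) (K : ℕ) (x h : ℝ) (hh : 0 ≤ h)
    (hh2 : h ≤ 1 / (Real.exp 1 * r K))
    (hx : ∀ n : ℕ, ‖iteratedDeriv n f x‖ ≤ Real.exp n * M n * Real.exp (-(K + 1 : ℝ))) :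
    ∀ n : ℕ, ‖iteratedDeriv n f (x + h)‖ ≤ Real.exp n * M n * Real.exp (-(K : ℝ)) := by
  have he := Real.exp_pos 1
  have key : ∀ j : ℕ, j ≤ K + 1 → ∀ s, 0 ≤ s → ‖iteratedDeriv (K + 1 - j) f (x + s)‖ ≤
      Real.exp ((K + 1 - j : ℕ) : ℝ) * M (K + 1 - j) * Real.exp (-(K + 1 : ℝ))
        * Real.exp (Real.exp 1 * r K * s) := by
    intro j
    induction j with
    | zero =>
      intro _ s hs
      have h1 : Real.exp ((K + 1 - 0 : ℕ) : ℝ) * M (K + 1 - 0) * Real.exp (-(K + 1 : ℝ))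
         = M (K + 1) := by
        have : Real.exp ((K + 1 : ℕ) : ℝ) * Real.exp (-(K + 1 : ℝ)) = 1 := by
          rw [← Real.exp_add]; simp
        simp only [Nat.sub_zero]
        linear_combination M (K + 1) * this
      rw [h1]
      refine (hb _ _).trans (le_mul_of_one_le_right (hM _).le ?_)
      apply Real.one_le_exp
      have := hr0 K
      positivity
    | succ j ih =>
      intro hj s hs
      obtain ⟨n, hn⟩ : ∃ n, n = K + 1 - (j + 1) := ⟨_, rfl⟩
      have hn1 : K + 1 - j = n + 1 := by omega
      have ih := ih (by omega)
      rw [hn1] at ih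
      rw [← hn]
      set D := Real.exp (n : ℝ) * M n * Real.exp (-(K + 1 : ℝ)) with hD
      have hD0 : 0 < D := by have := hM n; positivity
      set c := Real.exp 1 * r K with hc
      have hder : ∀ y, HasDerivAt (fun y => iteratedDeriv n f (x + y))
          (iteratedDeriv (n + 1) f (x + y)) y := by
        intro y
        have h1 : HasDerivAt (iteratedDeriv n f) (iteratedDeriv (n + 1) f (x + y)) (x + y) := by
          rw [iteratedDeriv_succ]
          apply DifferentiableAt.hasDerivAt
          exact (hf.differentiable_iteratedDeriv n (by exact_mod_cast ENat.natCast_lt_top n)) _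
        exact HasDerivAt.comp_const_add x y h1
      have := image_norm_le_of_norm_deriv_right_le_deriv_boundary
        (f := fun y => iteratedDeriv n f (x + y)) (a := 0) (b := s)
        (f' := fun y => iteratedDeriv (n + 1) f (x + y))
        (B := fun y => D * Real.exp (c * y)) (B' := fun y => D * (Real.exp (c * y) * (c * 1)))
        (fun y _ => (hder y).continuousAt.continuousWithinAt)
        (fun y _ => (hder y).hasDerivWithinAt)
        (by
          have := hx n
          simp only [add_zero, mul_zero, Real.exp_zero, mul_one]
          exact this)
        (fun y => (((hasDerivAt_id y).const_mul c).exp).const_mul D)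
        (fun y hy => by
          refine (ih y hy.1).trans ?_
          have h2 : Real.exp ((n + 1 : ℕ) : ℝ) * M (n + 1) * Real.exp (-(K + 1 : ℝ))
            ≤ D * c := by
            rw [hr n, hD, hc]; push_cast; rw [Real.exp_add]
            have h3 : r n ≤ r K := hmono (by omega)
            have h4 : 0 ≤ Real.exp (n : ℝ) * M n * Real.exp (-(K + 1 : ℝ)) * Real.exp 1 := by
              have := hM n; positivity
            nlinarith [mul_le_mul_of_nonneg_left h3 h4]
          calc _ ≤ D * c * Real.exp (c * y) := by gcongr
            _ = _ := by ring)
        (right_mem_Icc.2 hs)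
      exact this
  intro n
  have hee : Real.exp (-(K : ℝ)) = Real.exp (-(K + 1 : ℝ)) * Real.exp 1 := by
    rw [← Real.exp_add]; ring_nf
  rcases le_or_gt n (K + 1) with hn | hn
  · have := key (K + 1 - n) (by omega) h hh
    rw [Nat.sub_sub_self hn] at this
    refine this.trans ?_
    rw [hee, ← mul_assoc]
    have h5 : Real.exp 1 * r K * h ≤ 1 := by
      have h6 : 0 < Real.exp 1 * r K := mul_pos he (hr0 K)
      rw [le_div_iff₀ h6] at hh2; linarith
    have := hM n
    gcongr
  · refine (hb _ _).trans ?_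
    have : 1 ≤ Real.exp n * Real.exp (-(K : ℝ)) := by
      rw [← Real.exp_add]; apply Real.one_le_exp
      have : (K : ℝ) + 1 ≤ n := by exact_mod_cast hn.le
      linarith
    nlinarith [hM n]

theorem bang (f : ℝ → ℂ) (M : ℕ → ℝ) (hf : ContDiff ℝ (⊤ : ℕ∞) f)
    (hM : ∀ n, 0 < M n) (hlc : ∀ n, M (n + 1) ^ 2 ≤ M n * M (n + 2))
    (hb : ∀ n t, ‖iteratedDeriv n f t‖ ≤ M n)
    (hsum : ¬ Summable (fun n => M n / M (n + 1)))
    (h0 : ∀ n, iteratedDeriv n f 0 = 0) (t : ℝ) (ht : 0 ≤ t) : f t = 0 := by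
  set r : ℕ → ℝ := fun n => M (n + 1) / M n with hrdef
  have hr : ∀ n, M (n + 1) = r n * M n := fun n => by
    have := (hM n).ne'; simp only [hrdef]; field_simp
  have hr0 : ∀ n, 0 < r n := fun n => div_pos (hM _) (hM _)
  have hmono : Monotone r := monotone_nat_of_le_succ fun n => by
    simp only [hrdef]
    rw [div_le_div_iff₀ (hM _) (hM _)]
    nlinarith [hlc n]
  have he := Real.exp_pos 1
  have main : ∀ j K : ℕ, ∀ t : ℝ, 0 ≤ t →
      t ≤ ∑ i ∈ Finset.range j, 1 / (Real.exp 1 * r (K + i)) →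
      ∀ n : ℕ, ‖iteratedDeriv n f t‖ ≤ Real.exp n * M n * Real.exp (-(K : ℝ)) := by
    intro j
    induction j with
    | zero =>
      intro K t ht ht2 n
      simp only [Finset.range_zero, Finset.sum_empty] at ht2
      rw [le_antisymm ht2 ht, h0]
      have := hM n
      simp; positivity
    | succ j ih =>
      intro K t ht ht2
      rw [Finset.sum_range_succ'] at ht2
      set S := ∑ i ∈ Finset.range j, 1 / (Real.exp 1 * r (K + 1 + i)) with hS
      have hSe : ∑ i ∈ Finset.range j, 1 / (Real.exp 1 * r (K + (i + 1))) = S := by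
        refine Finset.sum_congr rfl fun i _ => ?_
        rw [show K + (i + 1) = K + 1 + i by ring]
      rw [hSe, add_zero] at ht2
      have hS0 : 0 ≤ S := Finset.sum_nonneg fun i _ => by have := hr0 (K + 1 + i); positivity
      have h1 := ih (K + 1) (min t S) (le_min ht hS0) (min_le_right _ _)
      have h2 := bang_step f M r hf hM hr hmono hr0 hb K (min t S) (t - min t S)
        (by linarith [min_le_left t S])
        (by
          rcases le_total t S with h | h
          · rw [min_eq_left h]; have := hr0 K; simp; positivity
          · rw [min_eq_right h]; linarith)
        (by push_cast at h1; exact h1)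
      simpa using h2
  have hall : ∀ K : ℕ, ‖f t‖ ≤ M 0 * Real.exp (-(K : ℝ)) := by
    intro K
    have hns : ¬ Summable (fun i => 1 / (Real.exp 1 * r (K + i))) := by
      intro hs
      apply hsum
      have h1 : Summable (fun i => 1 / (Real.exp 1 * r (i + K))) := by
        simpa only [add_comm] using hs
      have h2 := (summable_nat_add_iff (f := fun i => 1 / (Real.exp 1 * r i)) K).1 h1
      have h3 := h2.mul_left (Real.exp 1)
      refine h3.congr fun n => ?_
      have := (hM n).ne'
      have := (hM (n + 1)).ne'
      simp only [hrdef]; field_simp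
    have htend := (not_summable_iff_tendsto_nat_atTop_of_nonneg
      (fun i => by have := hr0 (K + i); positivity)).1 hns
    obtain ⟨j, hj⟩ := (htend.eventually_ge_atTop t).exists
    have := main j K t ht hj 0
    simpa using this
  have hlim : Tendsto (fun K : ℕ => M 0 * Real.exp (-(K : ℝ))) atTop (nhds 0) := by
    have := (Real.tendsto_exp_neg_atTop_nhds_zero.comp
      tendsto_natCast_atTop_atTop).const_mul (M 0)
    simpa using this
  have := ge_of_tendsto' hlim hall
  simpa using this

theorem abs_moment_logconvex (σ : Measure ℝ) (hi : ∀ n : ℕ, Integrable (fun x => |x| ^ n) σ)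
    (n : ℕ) : (∫ x, |x| ^ (n + 1) ∂σ) ^ 2 ≤ (∫ x, |x| ^ n ∂σ) * ∫ x, |x| ^ (n + 2) ∂σ := by
  have h : ∀ s : ℝ, 0 ≤ (∫ x, |x| ^ (n + 2) ∂σ) * (s * s) + (-2 * ∫ x, |x| ^ (n + 1) ∂σ) * s
      + ∫ x, |x| ^ n ∂σ := by
    intro s
    have e : ∫ x, |x| ^ n * (s * |x| - 1) ^ 2 ∂σ = (∫ x, |x| ^ (n + 2) ∂σ) * (s * s)
      + (-2 * ∫ x, |x| ^ (n + 1) ∂σ) * s + ∫ x, |x| ^ n ∂σ := by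
      have : (fun x : ℝ => |x| ^ n * (s * |x| - 1) ^ 2) = fun x =>
        (s * s) * |x| ^ (n + 2) + (-2 * s) * |x| ^ (n + 1) + |x| ^ n := by
        funext x; ring
      have hadd : Integrable (fun x => (s * s) * |x| ^ (n + 2) + (-2 * s) * |x| ^ (n + 1)) σ :=
        ((hi _).const_mul _).add ((hi _).const_mul _)
      rw [this, integral_add hadd (hi _),
        integral_add ((hi _).const_mul _) ((hi _).const_mul _),
        integral_const_mul, integral_const_mul]
      ring
    rw [← e]
    exact integral_nonneg fun x => by positivity
  have := discrim_le_zero h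
  rw [discrim] at this
  nlinarith

theorem hamburger_unique (σ τ : Measure ℝ) [IsFiniteMeasure σ] [IsFiniteMeasure τ]
    (hi : ∀ n : ℕ, Integrable (fun x => |x| ^ n) σ) (hj : ∀ n : ℕ, Integrable (fun x => |x| ^ n) τ)
    (hmom : ∀ n : ℕ, ∫ x, x ^ n ∂σ = ∫ x, x ^ n ∂τ)
    (hpos : ∀ n : ℕ, 0 < ∫ x, |x| ^ n ∂(σ + τ))
    (hsum : ¬ Summable (fun n : ℕ => (∫ x, |x| ^ n ∂(σ + τ)) / ∫ x, |x| ^ (n + 1) ∂(σ + τ))) :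
    σ = τ := by
  have hij : ∀ n : ℕ, Integrable (fun x => |x| ^ n) (σ + τ) := fun n => (hi n).add_measure (hj n)
  have mem : ∀ (ρ : Measure ℝ) [IsFiniteMeasure ρ],
      (∀ n : ℕ, Integrable (fun x => |x| ^ n) ρ) → ∀ n : ℕ, MemLp id n ρ := by
    intro ρ _ h n
    rcases Nat.eq_zero_or_pos n with rfl | hn
    · simpa using aestronglyMeasurable_id
    · rw [← integrable_norm_rpow_iff aestronglyMeasurable_id (by simpa using hn.ne')
        (by simp)]
      simpa using h n
  have mσ := mem σ hi
  have mτ := mem τ hj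
  have cσ : ContDiff ℝ (⊤ : ℕ∞) (charFun σ) := contDiff_charFun' mσ
  have cτ : ContDiff ℝ (⊤ : ℕ∞) (charFun τ) := contDiff_charFun' mτ
  have hid : ∀ (n : ℕ) t, iteratedDeriv n (charFun σ - charFun τ) t =
      iteratedDeriv n (charFun σ) t - iteratedDeriv n (charFun τ) t := by
    intro n t
    exact iteratedDeriv_sub ((cσ.of_le (by exact_mod_cast le_top)).contDiffAt)
      ((cτ.of_le (by exact_mod_cast le_top)).contDiffAt)
  have bd : ∀ (ρ : Measure ℝ) [IsFiniteMeasure ρ], (∀ n : ℕ, MemLp id n ρ) →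
      ∀ (n : ℕ) t, ‖iteratedDeriv n (charFun ρ) t‖ ≤ ∫ x, |x| ^ n ∂ρ := by
    intro ρ _ h n t
    rw [iteratedDeriv_charFun (h n), norm_mul, norm_pow, Complex.norm_I, one_pow, one_mul]
    refine (norm_integral_le_integral_norm _).trans (le_of_eq ?_)
    congr 1; funext x
    rw [norm_mul, norm_pow, Complex.norm_real, ← Complex.ofReal_mul, Complex.norm_exp_ofReal_mul_I]
    simp
  have hz : ∀ t, 0 ≤ t → (charFun σ - charFun τ) t = 0 := by
    refine bang _ (fun n => ∫ x, |x| ^ n ∂(σ + τ)) (cσ.sub cτ) hpos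
      (abs_moment_logconvex _ hij) ?_ hsum ?_
    · intro n t
      rw [hid, integral_add_measure (hi n) (hj n)]
      exact (norm_sub_le _ _).trans (add_le_add (bd σ mσ n t) (bd τ mτ n t))
    · intro n
      rw [hid, iteratedDeriv_charFun_zero (mσ n), iteratedDeriv_charFun_zero (mτ n), hmom, sub_self]
  apply Measure.ext_of_charFun
  funext t
  rcases le_total 0 t with ht | ht
  · exact sub_eq_zero.1 (hz t ht)
  · have := sub_eq_zero.1 (hz (-t) (by linarith))
    rw [charFun_neg, charFun_neg] at this
    exact (starRingEnd ℂ).injective this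

noncomputable def symSqrt (μ : Measure ℝ) : Measure ℝ :=
  μ.map Real.sqrt + μ.map (fun y => -Real.sqrt y)

theorem symSqrt_finite (μ : Measure ℝ) [IsFiniteMeasure μ] : IsFiniteMeasure (symSqrt μ) := by
  unfold symSqrt; infer_instance

theorem symSqrt_sq (μ : Measure ℝ) (h0 : μ (Iio 0) = 0) :
    (symSqrt μ).map (fun x => x ^ 2) = μ + μ := by
  have hae : ∀ᵐ y ∂μ, 0 ≤ y := by
    rw [ae_iff]; simpa [Iio] using h0
  unfold symSqrt
  rw [Measure.map_add _ _ (by fun_prop), Measure.map_map (by fun_prop) (by fun_prop),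
    Measure.map_map (by fun_prop) (by fun_prop)]
  congr 1
  all_goals
    conv_rhs => rw [← Measure.map_id (μ := μ)]
    apply Measure.map_congr
    filter_upwards [hae] with y hy
    simp [Real.sq_sqrt hy]

theorem symSqrt_integrable (μ : Measure ℝ) [IsFiniteMeasure μ]
    (hi : ∀ n : ℕ, Integrable (fun x => x ^ n) μ) (n : ℕ) :
    Integrable (fun y => Real.sqrt y ^ n) μ := by
  refine Integrable.mono' ((integrable_const 1).add (hi n).norm) (by fun_prop) ?_
  refine Eventually.of_forall fun y => ?_
  simp only [Pi.add_apply, norm_pow, Real.norm_eq_abs, abs_of_nonneg (Real.sqrt_nonneg y)]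
  rcases le_total (Real.sqrt y) 1 with h | h
  · have := pow_le_one₀ (n := n) (Real.sqrt_nonneg y) h
    have : 0 ≤ |y| ^ n := by positivity
    linarith
  · have hy : Real.sqrt y ≤ |y| := by
      have h2 : 0 ≤ y := by
        by_contra hc
        rw [Real.sqrt_eq_zero_of_nonpos (by linarith)] at h; linarith
      have := Real.sq_sqrt h2
      rw [abs_of_nonneg h2]; nlinarith
    have := pow_le_pow_left₀ (Real.sqrt_nonneg y) hy n
    linarith

theorem symSqrt_integrable_abs (μ : Measure ℝ) [IsFiniteMeasure μ]
    (hi : ∀ n : ℕ, Integrable (fun x => x ^ n) μ) (n : ℕ) :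
    Integrable (fun y => |y| ^ n) (symSqrt μ) := by
  have := symSqrt_integrable μ hi n
  refine Integrable.add_measure ?_ ?_
  · rw [integrable_map_measure (by fun_prop) (by fun_prop)]
    exact this.congr (Eventually.of_forall fun y => by simp [abs_of_nonneg (Real.sqrt_nonneg y)])
  · rw [integrable_map_measure (by fun_prop) (by fun_prop)]
    exact this.congr (Eventually.of_forall fun y => by simp [abs_of_nonneg (Real.sqrt_nonneg y)])

theorem symSqrt_integral (μ : Measure ℝ) [IsFiniteMeasure μ]
    (hi : ∀ n : ℕ, Integrable (fun x => x ^ n) μ) (n : ℕ) :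
    ∫ x, x ^ n ∂(symSqrt μ) = (1 + (-1) ^ n) * ∫ y, Real.sqrt y ^ n ∂μ := by
  have h := symSqrt_integrable μ hi n
  unfold symSqrt
  rw [integral_add_measure, integral_map (by fun_prop) (by fun_prop),
    integral_map (by fun_prop) (by fun_prop)]
  · have : (fun y => (-Real.sqrt y) ^ n) = fun y => (-1) ^ n * Real.sqrt y ^ n := by
      funext y; rw [neg_pow]
    rw [this, integral_const_mul]; ring
  · rw [integrable_map_measure (by fun_prop) (by fun_prop)]
    exact h
  · rw [integrable_map_measure (by fun_prop) (by fun_prop)]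
    refine (h.const_mul ((-1) ^ n)).congr (Eventually.of_forall fun y => ?_)
    simp [neg_pow (Real.sqrt y)]

theorem sqrt_even (μ : Measure ℝ) (h0 : μ (Iio 0) = 0) (k : ℕ) :
    ∫ y, Real.sqrt y ^ (2 * k) ∂μ = ∫ y, y ^ k ∂μ := by
  have hae : ∀ᵐ y ∂μ, 0 ≤ y := by
    rw [ae_iff]; simpa [Iio] using h0
  apply integral_congr_ae
  filter_upwards [hae] with y hy
  rw [pow_mul, Real.sq_sqrt hy]

theorem stieltjes_unique (μ ν : Measure ℝ) [IsFiniteMeasure μ] [IsFiniteMeasure ν]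
    (hμ0 : μ (Iio 0) = 0) (hν0 : ν (Iio 0) = 0)
    (hi : ∀ n : ℕ, Integrable (fun x => x ^ n) μ) (hj : ∀ n : ℕ, Integrable (fun x => x ^ n) ν)
    (hmom : ∀ n : ℕ, ∫ x, x ^ n ∂μ = ∫ x, x ^ n ∂ν)
    (hpos : ∀ n : ℕ, 0 < ∫ x, x ^ n ∂ν)
    (b : ℕ → ℝ) (hb : ∀ n, 0 < b n) (hbd : ∀ n : ℕ, ∫ x, x ^ (n + 1) ∂ν ≤ b n * ∫ x, x ^ n ∂ν)
    (hsum : ¬ Summable (fun n => 1 / Real.sqrt (b n))) : μ = ν := by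
  have := symSqrt_finite μ
  have := symSqrt_finite ν
  have iμ := symSqrt_integrable_abs μ hi
  have iν := symSqrt_integrable_abs ν hj
  set M : ℕ → ℝ := fun n => ∫ x, |x| ^ n ∂(symSqrt μ + symSqrt ν) with hMdef
  have hMlc : ∀ n, M (n + 1) ^ 2 ≤ M n * M (n + 2) :=
    abs_moment_logconvex _ (fun n => (iμ n).add_measure (iν n))
  have hM0 : ∀ n, 0 ≤ M n := fun n => integral_nonneg fun x => by positivity
  have hMe : ∀ k, M (2 * k) = 4 * ∫ x, x ^ k ∂ν := by
    intro k
    have e : ∀ x : ℝ, |x| ^ (2 * k) = x ^ (2 * k) := fun x => by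
      rw [pow_mul, pow_mul, sq_abs]
    simp only [hMdef]
    rw [integral_add_measure (iμ _) (iν _)]
    simp only [e]
    rw [symSqrt_integral μ hi, symSqrt_integral ν hj, sqrt_even μ hμ0, sqrt_even ν hν0, hmom]
    simp [pow_mul]; ring
  have hMe0 : ∀ k, 0 < M (2 * k) := fun k => by rw [hMe]; linarith [hpos k]
  have hMp : ∀ n, 0 < M n := by
    intro n
    rcases Nat.even_or_odd' n with ⟨k, rfl | rfl⟩
    · exact hMe0 k
    · rcases (hM0 (2 * k + 1)).lt_or_eq with h | h
      · exact h
      · have h1 := hMlc (2 * k + 1)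
        rw [← h, zero_mul] at h1
        have h2 := hMe0 (k + 1)
        rw [show 2 * (k + 1) = 2 * k + 1 + 1 by ring] at h2
        nlinarith
  have key : symSqrt μ = symSqrt ν := by
    refine hamburger_unique _ _ iμ iν ?_ hMp ?_
    · intro n
      rw [symSqrt_integral μ hi, symSqrt_integral ν hj]
      rcases Nat.even_or_odd' n with ⟨k, rfl | rfl⟩
      · rw [sqrt_even μ hμ0, sqrt_even ν hν0, hmom]
      · have : (1 + (-1 : ℝ) ^ (2 * k + 1)) = 0 := by simp [pow_succ, pow_mul]
        rw [this]; simp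
    · intro hs
      apply hsum
      have hs2 : Summable (fun n => M (2 * n) / M (2 * n + 1)) :=
        hs.comp_injective (i := fun n : ℕ => 2 * n) (fun a b h => by simpa using h)
      refine Summable.of_nonneg_of_le (fun n => by positivity) (fun n => ?_) hs2
      have h1 := hMlc (2 * n)
      have h2 : M (2 * n + 2) ≤ b n * M (2 * n) := by
        rw [show 2 * n + 2 = 2 * (n + 1) by ring, hMe, hMe]; linarith [hbd n]
      have h3 : M (2 * n + 1) ≤ Real.sqrt (b n) * M (2 * n) := by
        apply (pow_le_pow_iff_left₀ (hM0 _) (by have := hM0 (2 * n); positivity) two_ne_zero).1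
        rw [mul_pow, Real.sq_sqrt (hb n).le]
        nlinarith [hMp (2 * n)]
      rw [div_le_div_iff₀ (Real.sqrt_pos.2 (hb n)) (hMp _)]
      linarith
  have h2 : μ + μ = ν + ν := by
    rw [← symSqrt_sq μ hμ0, ← symSqrt_sq ν hν0, key]
  ext s _
  have h3 := congrArg (fun m : Measure ℝ => m s) h2
  simp only [Measure.add_apply, ← two_mul] at h3
  exact (ENNReal.mul_right_inj (by simp) (by simp)).1 h3

theorem lintegral_inv_sq (c : ℝ) (hc : 0 < c) :
    ∫⁻ x in Ici c, ENNReal.ofReal (1 / x ^ 2) = ENNReal.ofReal (1 / c) := by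
  have e : ∀ x ∈ Ioi c, x ^ (-2 : ℝ) = 1 / x ^ 2 := fun x hx => by
    have : 0 < x := hc.trans hx
    rw [Real.rpow_neg this.le]; norm_num
  have h1 : IntegrableOn (fun x : ℝ => 1 / x ^ 2) (Ioi c) :=
    (integrableOn_Ioi_rpow_of_lt (by norm_num) hc).congr_fun e measurableSet_Ioi
  have h2 : ∫ x in Ioi c, 1 / x ^ 2 = 1 / c := by
    rw [← setIntegral_congr_fun measurableSet_Ioi e, integral_Ioi_rpow_of_lt (by norm_num) hc]
    norm_num [Real.rpow_neg_one]
  rw [setLIntegral_congr Ioi_ae_eq_Ici.symm, ← ofReal_integral_eq_lintegral_ofReal h1, h2]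
  exact Eventually.of_forall fun x => by positivity

theorem count_bound (v : ℝ) (p : ℕ → Prop) (hp : ∀ n : ℕ, (n : ℝ) + 2 ≤ v → p n) :
    ENNReal.ofReal v ≤ 2 + ∑' n : ℕ, (open Classical in if p n then (1 : ENNReal) else 0) := by
  classical
  have h2 : ENNReal.ofReal v ≤ 2 + ENNReal.ofReal (v - 2) := by
    calc ENNReal.ofReal v = ENNReal.ofReal (2 + (v - 2)) := by ring_nf
      _ ≤ ENNReal.ofReal 2 + ENNReal.ofReal (v - 2) := ENNReal.ofReal_add_le
      _ = _ := by simp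
  refine h2.trans ?_
  gcongr
  rcases le_total v 2 with h | h
  · rw [ENNReal.ofReal_of_nonpos (by linarith)]; exact zero_le
  · have h3 : v - 2 ≤ ((⌊v - 2⌋₊ + 1 : ℕ) : ℝ) := by
      push_cast; exact (Nat.lt_floor_add_one _).le
    calc ENNReal.ofReal (v - 2) ≤ ((⌊v - 2⌋₊ + 1 : ℕ) : ENNReal) := by
          rw [← ENNReal.ofReal_natCast]; exact ENNReal.ofReal_le_ofReal h3
      _ = ∑ n ∈ Finset.range (⌊v - 2⌋₊ + 1), (if p n then (1 : ENNReal) else 0) := by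
          rw [Finset.sum_congr rfl (g := fun _ => (1 : ENNReal))]
          · simp
          · intro n hn
            rw [if_pos]
            apply hp
            have h4 : n ≤ ⌊v - 2⌋₊ := by simpa [Nat.lt_succ_iff] using hn
            have h5 := (Nat.le_floor_iff (by linarith)).1 h4
            linarith
      _ ≤ _ := ENNReal.sum_le_tsum _

theorem threshold (g : ℝ → ℝ) (a : ℝ) (ha : 1 < a)
    (hK : ∫⁻ x in Set.Ici a,
        ENNReal.ofReal (-Real.log (g (x ^ 2)) / (x ^ 2 * Real.log x)) = ⊤)
    (hu_mono : MonotoneOn (fun x => -Real.log (g x) / Real.log x) (Set.Ici a))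
    (hu_top : Tendsto (fun x => -Real.log (g x) / Real.log x) atTop atTop) :
    ∃ X : ℕ → ℝ, Monotone X ∧ (∀ n, a ≤ X n) ∧
      (∀ n x, X n < x → (n : ℝ) + 2 ≤ -Real.log (g x) / Real.log x) ∧
      ¬ Summable (fun n => 1 / Real.sqrt (X n)) := by
  set u : ℝ → ℝ := fun x => -Real.log (g x) / Real.log x with hu
  set S : ℕ → Set ℝ := fun n => {x | a ≤ x ∧ (n : ℝ) + 2 ≤ u x} with hS
  have hSne : ∀ n, (S n).Nonempty := fun n =>
    ((eventually_ge_atTop a).and (hu_top.eventually_ge_atTop ((n : ℝ) + 2))).exists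
  have hSb : ∀ n, BddBelow (S n) := fun n => ⟨a, fun x hx => hx.1⟩
  have hXa : ∀ n, a ≤ sInf (S n) := fun n => le_csInf (hSne n) fun x hx => hx.1
  refine ⟨fun n => sInf (S n), ?_, hXa, ?_, ?_⟩
  · refine monotone_nat_of_le_succ fun n => csInf_le_csInf (hSb n) (hSne _) ?_
    rintro x ⟨h1, h2⟩
    refine ⟨h1, ?_⟩
    push_cast at h2; linarith
  · intro n x hx
    obtain ⟨y, hy, hyx⟩ := exists_lt_of_csInf_lt (hSne n) hx
    exact hy.2.trans (hu_mono hy.1 (hy.1.trans hyx.le) hyx.le)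
  · intro hs
    classical
    have h0 : ∀ n, 0 < sInf (S n) := fun n => by linarith [hXa n]
    refine absurd hK (ne_of_lt ?_)
    have hle : ∀ x ∈ Ici a, ENNReal.ofReal (-Real.log (g (x ^ 2)) / (x ^ 2 * Real.log x)) ≤
        2 * ((2 + ∑' n : ℕ, (if Real.sqrt (sInf (S n)) ≤ x then (1 : ENNReal) else 0)) *
          ENNReal.ofReal (1 / x ^ 2)) := by
      intro x hx
      have hx : a ≤ x := hx
      have hx0 : 0 < x := by linarith
      have hl : 0 < Real.log x := Real.log_pos (by linarith)
      have e : -Real.log (g (x ^ 2)) / (x ^ 2 * Real.log x) = 2 * (u (x ^ 2) * (1 / x ^ 2)) := by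
        simp only [hu, Real.log_pow]; push_cast; field_simp
      rw [e, ENNReal.ofReal_mul (by norm_num), ENNReal.ofReal_mul' (by positivity)]
      simp only [ENNReal.ofReal_ofNat]
      gcongr
      convert count_bound (u (x ^ 2)) (fun n => Real.sqrt (sInf (S n)) ≤ x) ?_
      intro n hn
      rw [Real.sqrt_le_left hx0.le]
      exact csInf_le (hSb n) ⟨by nlinarith, hn⟩
    calc _ ≤ ∫⁻ x in Ici a, 2 * ((2 + ∑' n : ℕ,
            (if Real.sqrt (sInf (S n)) ≤ x then (1 : ENNReal) else 0)) *
          ENNReal.ofReal (1 / x ^ 2)) := setLIntegral_mono' measurableSet_Ici hle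
      _ ≤ 2 * (2 * ENNReal.ofReal (1 / a) + ∑' n, ENNReal.ofReal (1 / Real.sqrt (sInf (S n)))) := by
        rw [lintegral_const_mul' _ _ (by simp)]
        gcongr
        simp_rw [add_mul, ← ENNReal.tsum_mul_right]
        rw [lintegral_add_left (by fun_prop), lintegral_const_mul' _ _ (by simp),
          lintegral_inv_sq a (by linarith), lintegral_tsum]
        · gcongr with n
          rw [← lintegral_inv_sq _ (Real.sqrt_pos.2 (h0 n)),
            ← lintegral_indicator (s := Ici (Real.sqrt (sInf (S n)))) measurableSet_Ici]
          refine (setLIntegral_le_lintegral _ _).trans (le_of_eq ?_)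
          congr 1; funext x
          simp [indicator_apply]
        · intro n
          refine (Measurable.mul ?_ (by fun_prop)).aemeasurable
          exact Measurable.ite measurableSet_Ici measurable_const measurable_const
      _ < ⊤ := by
        have : ∑' n, ENNReal.ofReal (1 / Real.sqrt (sInf (S n))) ≠ ⊤ := hs.tsum_ofReal_ne_top
        exact ENNReal.mul_lt_top (by simp) (ENNReal.add_lt_top.2
          ⟨ENNReal.mul_lt_top (by simp) (by simp), this.lt_top⟩)

theorem ratio_bound (g : ℝ → ℝ) (a : ℝ) (ha : 1 < a)
    (hnn : ∀ x, 0 ≤ g x)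
    (hint : IntegrableOn g (Set.Ioi 0))
    (hpos : ∀ x, a ≤ x → 0 < g x)
    (hmom : ∀ k : ℕ, IntegrableOn (fun x => x ^ k * g x) (Set.Ioi 0))
    (X : ℕ → ℝ) (hXa : ∀ n, a ≤ X n)
    (hX : ∀ (n : ℕ) x, X n < x → (n : ℝ) + 2 ≤ -Real.log (g x) / Real.log x) :
    ∃ C, 1 ≤ C ∧ ∀ n : ℕ, 0 < (∫ x in Ioi (0 : ℝ), x ^ n * g x) ∧
      (∫ x in Ioi (0 : ℝ), x ^ (n + 1) * g x) ≤
        C * X (n + 1) * ∫ x in Ioi (0 : ℝ), x ^ n * g x := by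
  set c := ∫ x in Ioi a, g x with hc
  have hsub : Ioi a ⊆ Ioi (0 : ℝ) := Ioi_subset_Ioi (by linarith)
  have hc0 : 0 < c := by
    rw [hc, setIntegral_pos_iff_support_of_nonneg_ae (Eventually.of_forall hnn)
      (hint.mono_set hsub)]
    have : Function.support g ∩ Ioi a = Ioi a := by
      apply inter_eq_right.2
      intro x hx
      exact (hpos x (le_of_lt hx)).ne'
    rw [this]; simp
  have hlow : ∀ n : ℕ, c ≤ ∫ x in Ioi (0 : ℝ), x ^ n * g x := by
    intro n
    calc c ≤ ∫ x in Ioi a, x ^ n * g x := by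
          apply setIntegral_mono_on (hint.mono_set hsub) ((hmom n).mono_set hsub) measurableSet_Ioi
          intro x hx
          have : a < x := hx
          exact le_mul_of_one_le_left (hnn x) (one_le_pow₀ (by linarith))
      _ ≤ _ := by
          apply setIntegral_mono_set (hmom n) _ hsub.eventuallyLE
          filter_upwards [ae_restrict_mem measurableSet_Ioi] with x hx
          have : (0 : ℝ) < x := hx
          have := hnn x
          simp only [Pi.zero_apply]; positivity
  refine ⟨1 + 1 / c, by simp [hc0.le], fun n => ⟨hc0.trans_le (hlow n), ?_⟩⟩
  set Y := X (n + 1) with hY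
  have hYa : a ≤ Y := hXa _
  have hi2 : IntegrableOn (fun x : ℝ => x ^ (-2 : ℝ)) (Ioi Y) :=
    integrableOn_Ioi_rpow_of_lt (by norm_num) (by linarith)
  have hi2' : Integrable ((Ioi Y).indicator (fun x : ℝ => x ^ (-2 : ℝ)))
     (volume.restrict (Ioi (0 : ℝ))) :=
    ((integrable_indicator_iff measurableSet_Ioi).2 hi2).mono_measure Measure.restrict_le_self
  have hI : ∫ x in Ioi (0 : ℝ), (Ioi Y).indicator (fun x : ℝ => x ^ (-2 : ℝ)) x ≤ 1 := by
    rw [setIntegral_indicator measurableSet_Ioi, inter_eq_right.2 (Ioi_subset_Ioi (by linarith)),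
      integral_Ioi_rpow_of_lt (by norm_num) (by linarith)]
    norm_num [Real.rpow_neg_one]
    exact inv_le_one_of_one_le₀ (by linarith)
  have hpt : ∀ x ∈ Ioi (0 : ℝ), x ^ (n + 1) * g x ≤
      Y * (x ^ n * g x) + (Ioi Y).indicator (fun x : ℝ => x ^ (-2 : ℝ)) x := by
    intro x hx
    have hx : 0 < x := hx
    have hgx := hnn x
    rcases le_or_gt x Y with h | h
    · rw [indicator_of_notMem (by simpa using h), add_zero, pow_succ]
      have : 0 ≤ x ^ n * g x := by positivity
      nlinarith
    · rw [indicator_of_mem (by exact h)]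
      have h1 := hX (n + 1) x h
      have hl : 0 < Real.log x := Real.log_pos (by linarith)
      rw [le_div_iff₀ hl] at h1
      have hg : 0 < g x := hpos x (by linarith)
      have h2 : x ^ (n + 1) * g x ≤ x ^ (-2 : ℝ) := by
        rw [← Real.log_le_log_iff (by positivity) (by positivity),
          Real.log_mul (by positivity) hg.ne', Real.log_pow, Real.log_rpow hx]
        push_cast at h1 ⊢
        linarith
      have : 0 ≤ Y * (x ^ n * g x) := by
        have : 0 ≤ Y := by linarith
        positivity
      linarith
  have h1 : (∫ x in Ioi (0 : ℝ), x ^ (n + 1) * g x) ≤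
      Y * (∫ x in Ioi (0 : ℝ), x ^ n * g x) + 1 := by
    calc _ ≤ ∫ x in Ioi (0 : ℝ), (Y * (x ^ n * g x) +
          (Ioi Y).indicator (fun x : ℝ => x ^ (-2 : ℝ)) x) :=
          setIntegral_mono_on (hmom _) (((hmom n).const_mul Y).add hi2') measurableSet_Ioi hpt
      _ ≤ _ := by
        rw [integral_add ((hmom n).const_mul Y) hi2', integral_const_mul]
        gcongr
  refine h1.trans ?_
  have h3 := hlow n
  set A := ∫ x in Ioi (0 : ℝ), x ^ n * g x
  have h4 : 1 ≤ 1 / c * (Y * A) := by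
    rw [div_mul_eq_mul_div, le_div_iff₀ hc0]; nlinarith
  linarith [show (1 + 1 / c) * Y * A = Y * A + 1 / c * (Y * A) by ring]

/-- Theorem 2, Stieltjes case: under the divergence condition (3)
and the monotone growth condition (4), the density g on [0,∞) satisfies the
Stieltjes Carleman condition and Y is moment-determinate on [0,∞). -/
theorem stmt_3 (g : ℝ → ℝ) (a : ℝ) (ha : 1 < a)
    (hnn : ∀ x, 0 ≤ g x)
    (hdens : ∫ x in Set.Ioi (0 : ℝ), g x = 1)
    (hint : IntegrableOn g (Set.Ioi 0))
    (hcont : ContinuousOn g (Set.Ici a))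
    (hpos : ∀ x, a ≤ x → 0 < g x)
    (hmom : ∀ k : ℕ, IntegrableOn (fun x => x ^ k * g x) (Set.Ioi 0))
    -- condition (3)
    (hK : ∫⁻ x in Set.Ici a,
        ENNReal.ofReal (-Real.log (g (x ^ 2)) / (x ^ 2 * Real.log x)) = ⊤)
    -- condition (4)
    (hu_mono : MonotoneOn (fun x => -Real.log (g x) / Real.log x) (Set.Ici a))
    (hu_top : Tendsto (fun x => -Real.log (g x) / Real.log x) atTop atTop) :
    -- Carleman's condition (Stieltjes case)
    (¬ Summable (fun k : ℕ =>
        (∫ x in Set.Ioi (0 : ℝ), x ^ (k + 1) * g x) ^ (-(1 / (2 * ((k : ℝ) + 1)))))) ∧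
    -- moment determinacy on [0,∞)
    (∀ μ : Measure ℝ, IsProbabilityMeasure μ → μ (Set.Iio 0) = 0 →
        (∀ k : ℕ, ∫ x, x ^ k ∂μ = ∫ x in Set.Ioi (0 : ℝ), x ^ k * g x) →
        μ = (MeasureTheory.volume.restrict (Set.Ioi 0)).withDensity
              (fun x => ENNReal.ofReal (g x))) := by
  obtain ⟨X, hXm, hXa, hX, hXs⟩ := threshold g a ha hK hu_mono hu_top
  obtain ⟨C, hC1, hC⟩ := ratio_bound g a ha hnn hint hpos hmom X hXa hX
  set A : ℕ → ℝ := fun n => ∫ x in Ioi (0 : ℝ), x ^ n * g x with hA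
  have hA0 : A 0 = 1 := by simpa [hA] using hdens
  have hC0 : 0 < C := by linarith
  have hX0 : ∀ n, 0 < X n := fun n => by linarith [hXa n]
  have hCX : ∀ n, 0 < C * X n := fun n => mul_pos hC0 (hX0 n)
  have hns : ¬ Summable (fun n => 1 / Real.sqrt (C * X (n + 1))) := by
    intro hs
    apply hXs
    rw [← summable_nat_add_iff 1]
    refine (hs.mul_left (Real.sqrt C)).congr fun n => ?_
    have := Real.sqrt_pos.2 hC0
    have := Real.sqrt_pos.2 (hX0 (n + 1))
    rw [Real.sqrt_mul hC0.le]; field_simp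
  refine ⟨?_, ?_⟩
  · intro hs
    apply hns
    refine Summable.of_nonneg_of_le (fun n => by positivity) (fun n => ?_) hs
    have hpow : ∀ m, A m ≤ (C * X m) ^ m := by
      intro m
      induction m with
      | zero => simp [hA0]
      | succ m ih =>
        calc A (m + 1) ≤ C * X (m + 1) * A m := (hC m).2
          _ ≤ C * X (m + 1) * (C * X m) ^ m := mul_le_mul_of_nonneg_left ih (hCX _).le
          _ ≤ C * X (m + 1) * (C * X (m + 1)) ^ m := by
            have := hXm (Nat.le_succ m)
            have := (hCX m).le
            have := (hCX (m + 1)).le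
            gcongr
          _ = _ := by ring
    have h1 := Real.rpow_le_rpow_of_nonpos (hC (n + 1)).1 (hpow (n + 1))
      (z := -(1 / (2 * ((n : ℝ) + 1)))) (by rw [neg_nonpos]; positivity)
    refine le_trans (le_of_eq ?_) h1
    rw [← Real.rpow_natCast, ← Real.rpow_mul (hCX _).le, Real.sqrt_eq_rpow, one_div,
      ← Real.rpow_neg (hCX _).le]
    congr 1
    push_cast
    field_simp
  · intro μ hμ hμ0 hμm
    set ν := (MeasureTheory.volume.restrict (Set.Ioi 0)).withDensity
              (fun x => ENNReal.ofReal (g x)) with hν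
    have hgm : AEMeasurable g (volume.restrict (Ioi 0)) := hint.aestronglyMeasurable.aemeasurable
    have hfin : IsFiniteMeasure ν := isFiniteMeasure_withDensity_ofReal hint.2
    have hνint : ∀ f : ℝ → ℝ, ∫ x, f x ∂ν = ∫ x in Ioi (0 : ℝ), f x * g x := by
      intro f
      rw [hν, integral_withDensity_eq_integral_toReal_smul₀ hgm.ennreal_ofReal
        (Eventually.of_forall fun x => by simp)]
      congr 1; funext x
      simp [ENNReal.toReal_ofReal (hnn x), mul_comm]
    have hνi : ∀ n : ℕ, Integrable (fun x => x ^ n) ν := by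
      intro n
      rw [hν, integrable_withDensity_iff_integrable_smul₀' hgm.ennreal_ofReal
        (Eventually.of_forall fun x => by simp)]
      refine (hmom n).congr (Eventually.of_forall fun x => ?_)
      simp [ENNReal.toReal_ofReal (hnn x), mul_comm]
    refine stieltjes_unique μ ν hμ0 ?_ ?_ hνi ?_ ?_ (fun n => C * X (n + 1)) (fun n => hCX _)
      ?_ hns
    · have h1 : (volume.restrict (Ioi (0 : ℝ))) (Iio 0) = 0 := by
        rw [Measure.restrict_apply measurableSet_Iio]
        have : Iio (0 : ℝ) ∩ Ioi 0 = ∅ := by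
          ext x; simp only [mem_inter_iff, mem_Iio, mem_Ioi, mem_empty_iff_false]
          constructor
          · rintro ⟨h, h'⟩; linarith
          · exact False.elim
        simp [this]
      exact withDensity_absolutelyContinuous _ _ h1
    · intro n
      apply Integrable.of_integral_ne_zero
      rw [hμm]; exact (hC n).1.ne'
    · intro n; rw [hμm, hνint]
    · intro n; rw [hνint]; exact (hC n).1
    · intro n; rw [hνint, hνint]; exact (hC n).2
end

section
/- Let X be a symmetric integer-valued random variable with P[X = j] = p_j > 0 for all j ∈ ℤ, all moments finite, satisfying: (9) ∑_{|j| ≥ j0} (-ln p_j)/(j² ln|j|) = ∞ for some integer j0 ≥ 2, and (10) the sequence j ↦ (-ln p_j)/ln j is monotone increasing to infinity for j ≥ j0. Then X satisfies Carleman's condition ∑_{k≥1} (E[X^{2k}])^{-1/(2k)} = ∞, and hence X is moment-determinate. -/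
open Filter Set MeasureTheory

lemma bang_ratio (M : ℕ → ℝ) (hM : ∀ n, 0 < M n) (hlc : ∀ n, M (n+1)^2 ≤ M n * M (n+2)) :
    Monotone (fun n => M (n+1) / M n) := by
  apply monotone_nat_of_le_succ
  intro n
  rw [div_le_div_iff₀ (hM _) (hM _)]
  nlinarith [hlc n]

lemma bang_pow (M : ℕ → ℝ) (hM : ∀ n, 0 < M n) (hlc : ∀ n, M (n+1)^2 ≤ M n * M (n+2))
    (N j : ℕ) : ∀ i, j + i ≤ N + 1 → M (j+i) ≤ M j * (M (N+1) / M N)^i := by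
  intro i
  induction i with
  | zero => intro _; simp
  | succ i ih =>
    intro h
    have h1 := ih (by omega)
    have h2 : M (j+i+1) / M (j+i) ≤ M (N+1) / M N := bang_ratio M hM hlc (by omega : j + i ≤ N)
    have h3 : M (j+i+1) = M (j+i) * (M (j+i+1) / M (j+i)) := by
      field_simp [(hM (j+i)).ne']
    have hr : 0 < M (N+1) / M N := div_pos (hM _) (hM _)
    calc M (j+(i+1)) = M (j+i) * (M (j+i+1) / M (j+i)) := h3
      _ ≤ (M j * (M (N+1) / M N)^i) * (M (N+1) / M N) := by
        apply mul_le_mul h1 h2 (div_pos (hM _) (hM _)).le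
        exact mul_nonneg (hM _).le (by positivity)
      _ = _ := by ring

lemma bang_step_s7 (F : ℕ → ℝ → ℂ) (M : ℕ → ℝ) (hM : ∀ n, 0 < M n)
    (hlc : ∀ n, M (n+1)^2 ≤ M n * M (n+2)) (hb : ∀ n x, ‖F n x‖ ≤ M n)
    (hT : ∀ (j n : ℕ) (x h : ℝ), 0 ≤ h →
      ‖F j (x+h) - ∑ i ∈ Finset.range n, (h^i/(i.factorial : ℝ)) • F (j+i) x‖
        ≤ h^n/(n.factorial : ℝ) * M (j+n))
    (N : ℕ) (x h : ℝ) (hh : 0 ≤ h) (hle : Real.exp 1 * h * (M (N+1) / M N) ≤ 1)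
    (hP : ∀ j : ℕ, ‖F j x‖ ≤ Real.exp ((j:ℝ) - ((N + 1 : ℕ) : ℝ)) * M j) :
    ∀ j : ℕ, ‖F j (x+h)‖ ≤ Real.exp ((j:ℝ) - (N:ℝ)) * M j := by
  intro j
  rcases le_total N j with hj | hj
  · have : (1:ℝ) ≤ Real.exp ((j:ℝ) - (N:ℝ)) := by
      apply Real.one_le_exp
      have : (N:ℝ) ≤ j := by exact_mod_cast hj
      linarith
    have h1 := hb j (x+h)
    nlinarith [hM j]
  · obtain ⟨n, hn⟩ : ∃ n, j + n = N + 1 := ⟨N + 1 - j, by omega⟩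
    have hr : 0 < M (N+1) / M N := div_pos (hM _) (hM _)
    set r := M (N+1) / M N with hrdef
    set c := Real.exp ((j:ℝ) - ((N + 1 : ℕ) : ℝ)) with hc
    have hcpos : 0 < c := Real.exp_pos _
    have key : ∀ i, j + i ≤ N + 1 → Real.exp (((j+i : ℕ):ℝ) - ((N + 1 : ℕ) : ℝ)) * M (j+i)
        ≤ c * M j * (Real.exp 1 * r)^i := by
      intro i hi
      have e1 : Real.exp (((j+i : ℕ):ℝ) - ((N + 1 : ℕ) : ℝ)) = c * Real.exp 1 ^ i := by
        rw [hc, ← Real.exp_nat_mul, ← Real.exp_add]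
        congr 1
        push_cast
        ring
      rw [e1]
      have := bang_pow M hM hlc N j i hi
      calc c * Real.exp 1 ^ i * M (j+i) ≤ c * Real.exp 1 ^ i * (M j * r^i) := by gcongr
        _ = _ := by ring
    have hsum : ‖∑ i ∈ Finset.range n, (h^i/(i.factorial : ℝ)) • F (j+i) x‖
        ≤ ∑ i ∈ Finset.range n, c * M j * ((Real.exp 1 * h * r)^i / (i.factorial:ℝ)) := by
      apply norm_sum_le_of_le
      intro i hi
      rw [Finset.mem_range] at hi
      rw [norm_smul, Real.norm_of_nonneg (by positivity)]
      calc h^i/(i.factorial : ℝ) * ‖F (j+i) x‖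
          ≤ h^i/(i.factorial : ℝ) * (c * M j * (Real.exp 1 * r)^i) := by
            gcongr
            exact (hP (j+i)).trans (key i (by omega))
        _ = _ := by ring
    have hrem := hT j n x h hh
    have hlast : h^n/(n.factorial : ℝ) * M (j+n)
        ≤ c * M j * ((Real.exp 1 * h * r)^n / (n.factorial:ℝ)) := by
      have := key n (by omega)
      rw [hn] at this
      simp only [sub_self, Real.exp_zero, one_mul] at this
      rw [hn]
      calc h^n/(n.factorial : ℝ) * M (N+1)
          ≤ h^n/(n.factorial : ℝ) * (c * M j * (Real.exp 1 * r)^n) := by gcongr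
        _ = _ := by ring
    have htot : ‖F j (x+h)‖ ≤ ∑ i ∈ Finset.range (n+1),
        c * M j * ((Real.exp 1 * h * r)^i / (i.factorial:ℝ)) := by
      rw [Finset.sum_range_succ]
      have := norm_sub_norm_le (F j (x+h)) (∑ i ∈ Finset.range n, (h^i/(i.factorial : ℝ)) • F (j+i) x)
      linarith
    rw [← Finset.mul_sum] at htot
    have hexp : ∑ i ∈ Finset.range (n+1), (Real.exp 1 * h * r)^i / (i.factorial:ℝ) ≤ Real.exp 1 :=
      (Real.sum_le_exp_of_nonneg (by positivity) _).trans (Real.exp_le_exp.mpr hle)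
    have hMj := hM j
    calc ‖F j (x+h)‖ ≤ c * M j * Real.exp 1 := htot.trans (by gcongr)
      _ = Real.exp 1 * c * M j := by ring
      _ = _ := by
        rw [hc, ← Real.exp_add]
        congr 2
        push_cast
        ring

lemma bang_main (F : ℕ → ℝ → ℂ) (M : ℕ → ℝ) (hM : ∀ n, 0 < M n)
    (hlc : ∀ n, M (n+1)^2 ≤ M n * M (n+2)) (hb : ∀ n x, ‖F n x‖ ≤ M n)
    (hT : ∀ (j n : ℕ) (x h : ℝ), 0 ≤ h →
      ‖F j (x+h) - ∑ i ∈ Finset.range n, (h^i/(i.factorial : ℝ)) • F (j+i) x‖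
        ≤ h^n/(n.factorial : ℝ) * M (j+n))
    (h0 : ∀ n, F n 0 = 0) (hdiv : ¬ Summable (fun n => M n / M (n+1))) :
    ∀ x, 0 ≤ x → F 0 x = 0 := by
  have hq : ∀ n, 0 < M n / M (n+1) := fun n => div_pos (hM _) (hM _)
  have claim : ∀ (K n : ℕ) (x : ℝ), 0 ≤ x →
      x ≤ ∑ i ∈ Finset.range K, (Real.exp 1)⁻¹ * (M (n+i) / M (n+i+1)) →
      ∀ j : ℕ, ‖F j x‖ ≤ Real.exp ((j:ℝ) - (n:ℝ)) * M j := by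
    intro K
    induction K with
    | zero =>
      intro n x hx hx' j
      simp only [Finset.range_zero, Finset.sum_empty] at hx'
      rw [le_antisymm hx' hx, h0, norm_zero]
      have := hM j
      positivity
    | succ K ih =>
      intro n x hx hx'
      rw [Finset.sum_range_succ'] at hx'
      set d := (Real.exp 1)⁻¹ * (M n / M (n+1)) with hd
      have hdpos : 0 < d := mul_pos (by positivity) (hq n)
      have hx2 : max (x - d) 0 ≤ ∑ i ∈ Finset.range K, (Real.exp 1)⁻¹ * (M (n+1+i) / M (n+1+i+1)) := by
        apply max_le
        · have e : ∑ i ∈ Finset.range K, (Real.exp 1)⁻¹ * (M (n+(i+1)) / M (n+(i+1)+1))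
              = ∑ i ∈ Finset.range K, (Real.exp 1)⁻¹ * (M (n+1+i) / M (n+1+i+1)) := by
            apply Finset.sum_congr rfl
            intro i _
            rw [show n + (i + 1) = n + 1 + i by ring]
          rw [e, add_zero] at hx'
          linarith
        · exact Finset.sum_nonneg fun i _ => mul_nonneg (by positivity) (hq _).le
      have := ih (n+1) _ (le_max_right _ _) hx2
      have st := bang_step_s7 F M hM hlc hb hT n (max (x-d) 0) (x - max (x-d) 0)
        (by rw [sub_nonneg]; exact max_le (by linarith) hx) ?_ this
      · simpa using st
      · have h1 : x - max (x-d) 0 ≤ d := by linarith [le_max_left (x-d) 0]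
        have hr : 0 < M (n+1) / M n := div_pos (hM _) (hM _)
        calc Real.exp 1 * (x - max (x-d) 0) * (M (n+1) / M n) ≤ Real.exp 1 * d * (M (n+1) / M n) := by
              gcongr
          _ = 1 := by
            rw [hd]
            have := (hM n).ne'
            have := (hM (n+1)).ne'
            field_simp
  intro x hx
  have hall : ∀ n : ℕ, ‖F 0 x‖ ≤ Real.exp (-(n:ℝ)) * M 0 := by
    intro n
    have hdiv' : ¬ Summable (fun i => (Real.exp 1)⁻¹ * (M (n+i) / M (n+i+1))) := by
      intro hs
      apply hdiv
      rw [summable_mul_left_iff (by positivity)] at hs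
      rw [← summable_nat_add_iff n]
      simpa [add_comm, add_left_comm, add_assoc] using hs
    have ht := (not_summable_iff_tendsto_nat_atTop_of_nonneg
      (fun i => mul_nonneg (by positivity) (hq _).le)).mp hdiv'
    obtain ⟨K, hK⟩ := (ht.eventually_ge_atTop x).exists
    simpa using claim K n x hx hK 0
  have hlim : Tendsto (fun n : ℕ => Real.exp (-(n:ℝ)) * M 0) atTop (nhds (0 * M 0)) :=
    (Real.tendsto_exp_neg_atTop_nhds_zero.comp tendsto_natCast_atTop_atTop).mul_const _
  rw [zero_mul] at hlim
  have := ge_of_tendsto' hlim hall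
  exact norm_le_zero_iff.mp this

lemma carleman_ineq (a : ℕ → ℝ) (ha : ∀ n, 0 ≤ a n) (hs : Summable a) :
    Summable (fun n : ℕ => (∏ i ∈ Finset.range (n+1), a i) ^ (1 / ((n:ℝ)+1))) := by
  set S : ℕ → ℝ := fun N => ∑ i ∈ Finset.range N, ((i:ℝ)+1) * a i with hS
  have hS0 : ∀ N, 0 ≤ S N := fun N => Finset.sum_nonneg fun i _ => mul_nonneg (by positivity) (ha i)
  have hT : ∀ K, ∑ n ∈ Finset.range K, S (n+1) / ((n:ℝ)+1)^2
      ≤ 2 * (∑ i ∈ Finset.range K, a i - S K / ((K:ℝ)+1)) := by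
    intro K
    induction K with
    | zero => simp [hS]
    | succ K ih =>
      rw [Finset.sum_range_succ, Finset.sum_range_succ]
      have e : S (K+1) = S K + ((K:ℝ)+1) * a K := by simp only [hS]; rw [Finset.sum_range_succ]
      have h1 : S (K+1) / ((K:ℝ)+1)^2 ≤ 2 * (S (K+1) / ((K:ℝ)+1) - S (K+1) / ((K:ℝ)+1+1)) := by
        have : 1 / ((K:ℝ)+1)^2 ≤ 2 * (1 / ((K:ℝ)+1) - 1 / ((K:ℝ)+1+1)) := by
          have hk : (0:ℝ) ≤ K := Nat.cast_nonneg K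
          have : 2 * (1 / ((K:ℝ)+1) - 1 / ((K:ℝ)+1+1)) = 2 / (((K:ℝ)+1) * ((K:ℝ)+1+1)) := by
            field_simp
            ring
          rw [this, div_le_div_iff₀ (by positivity) (by positivity)]
          nlinarith
        have := mul_le_mul_of_nonneg_left this (hS0 (K+1))
        calc _ = S (K+1) * (1 / ((K:ℝ)+1)^2) := by ring
          _ ≤ _ := this
          _ = _ := by ring
      have h2 : S (K+1) / ((K:ℝ)+1) = S K / ((K:ℝ)+1) + a K := by
        rw [e]; field_simp
      push_cast
      linarith
  have hsum : Summable (fun n : ℕ => S (n+1) / ((n:ℝ)+1)^2) := by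
    apply summable_of_sum_range_le (c := 2 * ∑' i, a i)
    · intro n; exact div_nonneg (hS0 _) (by positivity)
    · intro K
      have h1 := hT K
      have h2 : 0 ≤ S K / ((K:ℝ)+1) := div_nonneg (hS0 _) (by positivity)
      have h3 := hs.sum_le_tsum (Finset.range K) (fun i _ => ha i)
      linarith
  refine Summable.of_nonneg_of_le (fun n => Real.rpow_nonneg (Finset.prod_nonneg fun i _ => ha i) _) ?_
    (hsum.mul_left (Real.exp 1))
  intro n
  have hn : (0:ℝ) < (n:ℝ)+1 := by positivity
  have amgm := Real.geom_mean_le_arith_mean (Finset.range (n+1)) (fun _ => (1:ℝ))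
    (fun i => ((i:ℝ)+1) * a i) (by simp) (by simp; positivity)
    (fun i _ => mul_nonneg (by positivity) (ha i))
  simp only [Real.rpow_one, one_mul, Finset.sum_const, Finset.card_range, nsmul_eq_mul, mul_one,
    Nat.cast_add, Nat.cast_one] at amgm
  rw [Finset.prod_mul_distrib] at amgm
  have hfac : ∏ i ∈ Finset.range (n+1), ((i:ℝ)+1) = ((n+1).factorial : ℝ) := by
    rw [← Finset.prod_range_add_one_eq_factorial]; push_cast; rfl
  rw [hfac, Real.mul_rpow (by positivity) (Finset.prod_nonneg fun i _ => ha i)] at amgm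
  have hf : ((n:ℝ)+1) / Real.exp 1 ≤ ((n+1).factorial : ℝ) ^ ((n:ℝ)+1)⁻¹ := by
    have h1 := Real.pow_div_factorial_le_exp _ hn.le (n+1)
    have h2 : (((n:ℝ)+1) / Real.exp 1)^(n+1) ≤ ((n+1).factorial : ℝ) := by
      rw [div_pow, ← Real.exp_nat_mul]
      rw [div_le_iff₀ (by positivity)] at h1 ⊢
      push_cast
      rw [mul_one]; linarith
    have h3 := Real.rpow_le_rpow (by positivity) h2 (inv_nonneg.mpr hn.le)
    have h4 := Real.pow_rpow_inv_natCast (x := ((n:ℝ)+1) / Real.exp 1) (by positivity) (Nat.succ_ne_zero n)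
    simp only [Nat.succ_eq_add_one, Nat.cast_add, Nat.cast_one] at h4
    rwa [h4] at h3
  rw [one_div]
  set P := (∏ i ∈ Finset.range (n+1), a i) ^ ((n:ℝ)+1)⁻¹ with hP
  have hP0 : 0 ≤ P := Real.rpow_nonneg (Finset.prod_nonneg fun i _ => ha i) _
  have h5 : ((n:ℝ)+1) / Real.exp 1 * P ≤ S (n+1) / ((n:ℝ)+1) :=
    (mul_le_mul_of_nonneg_right hf hP0).trans amgm
  calc P = Real.exp 1 / ((n:ℝ)+1) * (((n:ℝ)+1) / Real.exp 1 * P) := by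
        field_simp
    _ ≤ Real.exp 1 / ((n:ℝ)+1) * (S (n+1) / ((n:ℝ)+1)) := by gcongr
    _ = _ := by field_simp

lemma exp_taylor (c : ℂ) (hc : c.re = 0) (n : ℕ) : ∀ s : ℝ, 0 ≤ s →
    ‖Complex.exp (s * c) - ∑ i ∈ Finset.range n, (s^i / (i.factorial:ℝ)) • c^i‖
      ≤ s^n / (n.factorial:ℝ) * ‖c‖^n := by
  induction n with
  | zero =>
    intro s hs
    simp [Complex.norm_exp, hc]
  | succ n ih =>
    intro s hs
    have hd : ∀ (i : ℕ) (x : ℝ), HasDerivAt (fun s : ℝ => s^(i+1) / ((i+1).factorial:ℝ))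
        (x^i / (i.factorial:ℝ)) x := by
      intro i x
      have := (hasDerivAt_pow (i+1) x).div_const ((i+1).factorial:ℝ)
      convert! this using 1
      rw [Nat.factorial_succ]
      push_cast
      field_simp
    have hder : ∀ x : ℝ, HasDerivAt (fun s : ℝ => Complex.exp (s * c) -
        ∑ i ∈ Finset.range (n+1), (s^i / (i.factorial:ℝ)) • c^i)
        (c * (Complex.exp (x * c) - ∑ i ∈ Finset.range n, (x^i / (i.factorial:ℝ)) • c^i)) x := by
      intro x
      have h1 : HasDerivAt (fun s : ℝ => Complex.exp (s * c)) (c * Complex.exp (x * c)) x := by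
        have := ((Complex.ofRealCLM.hasDerivAt (x := x)).mul_const c).cexp
        convert! this using 1
        simp [mul_comm]
      have h2 : HasDerivAt (fun s : ℝ => ∑ i ∈ Finset.range (n+1), (s^i / (i.factorial:ℝ)) • c^i)
          (c * ∑ i ∈ Finset.range n, (x^i / (i.factorial:ℝ)) • c^i) x := by
        have : (fun s : ℝ => ∑ i ∈ Finset.range (n+1), (s^i / (i.factorial:ℝ)) • c^i) =
          fun s : ℝ => ∑ i ∈ Finset.range n, (s^(i+1) / ((i+1).factorial:ℝ)) • c^(i+1) + 1 := by
          funext s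
          rw [Finset.sum_range_succ']
          simp
        rw [this, Finset.mul_sum]
        apply HasDerivAt.add_const
        apply HasDerivAt.fun_sum
        intro i _
        have := (hd i x).smul_const (c^(i+1))
        convert! this using 1
        rw [mul_smul_comm]
        ring_nf
      rw [mul_sub]
      exact h1.sub h2
    have := image_norm_le_of_norm_deriv_right_le_deriv_boundary (a := 0) (b := s)
      (f := fun s : ℝ => Complex.exp (s * c) -
        ∑ i ∈ Finset.range (n+1), (s^i / (i.factorial:ℝ)) • c^i)
      (f' := fun x => c * (Complex.exp (x * c) - ∑ i ∈ Finset.range n, (x^i / (i.factorial:ℝ)) • c^i))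
      (B := fun s => s^(n+1) / ((n+1).factorial:ℝ) * ‖c‖^(n+1))
      (B' := fun s => s^n / (n.factorial:ℝ) * ‖c‖^(n+1))
      (fun x _ => (hder x).continuousAt.continuousWithinAt)
      (fun x _ => (hder x).hasDerivWithinAt)
      (by simp [Finset.sum_range_succ'])
      (fun x => (hd n x).mul_const _)
      (fun x hx => by
        rw [norm_mul]
        have := ih x hx.1
        calc _ ≤ ‖c‖ * (x^n / (n.factorial:ℝ) * ‖c‖^n) := by gcongr
          _ = _ := by ring)
    exact this ⟨hs, le_refl _⟩

/-- derivative of the characteristic function -/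
noncomputable def cfd (μ : Measure ℝ) (n : ℕ) (t : ℝ) : ℂ :=
  ∫ x : ℝ, ((x:ℂ) * Complex.I)^n * Complex.exp (t * ((x:ℂ) * Complex.I)) ∂μ

lemma norm_cexp_aux (t x : ℝ) : ‖Complex.exp (t * ((x:ℂ) * Complex.I))‖ = 1 := by
  rw [← mul_assoc, ← Complex.ofReal_mul, Complex.norm_exp_ofReal_mul_I]

lemma norm_xI (x : ℝ) : ‖(x:ℂ) * Complex.I‖ = |x| := by simp

lemma int_abs {μ : Measure ℝ} (hμ : ∀ k : ℕ, Integrable (fun x : ℝ => x^k) μ) (k : ℕ) :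
    Integrable (fun x : ℝ => |x|^k) μ := by
  simpa using (hμ k).norm

lemma cfd_int {μ : Measure ℝ} (hμ : ∀ k : ℕ, Integrable (fun x : ℝ => x^k) μ) (n : ℕ) (t : ℝ) :
    Integrable (fun x : ℝ => ((x:ℂ) * Complex.I)^n * Complex.exp (t * ((x:ℂ) * Complex.I))) μ := by
  refine (int_abs hμ n).mono' ?_ ?_
  · exact Continuous.aestronglyMeasurable (by fun_prop)
  · refine ae_of_all _ fun x => ?_
    rw [norm_mul, norm_pow, norm_xI, norm_cexp_aux, mul_one]

lemma cfd_bound {μ : Measure ℝ} (n : ℕ) (t : ℝ) :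
    ‖cfd μ n t‖ ≤ ∫ x, |x|^n ∂μ := by
  refine (norm_integral_le_integral_norm _).trans (le_of_eq ?_)
  congr 1
  funext x
  rw [norm_mul, norm_pow, norm_xI, norm_cexp_aux, mul_one]

lemma cfd_taylor {μ : Measure ℝ} (hμ : ∀ k : ℕ, Integrable (fun x : ℝ => x^k) μ)
    (j n : ℕ) (t h : ℝ) (hh : 0 ≤ h) :
    ‖cfd μ j (t+h) - ∑ i ∈ Finset.range n, (h^i/(i.factorial : ℝ)) • cfd μ (j+i) t‖
        ≤ h^n/(n.factorial : ℝ) * ∫ x, |x|^(j+n) ∂μ := by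
  unfold cfd
  simp_rw [← integral_smul]
  have hi : ∀ i ∈ Finset.range n, Integrable (fun x : ℝ => (h^i/(i.factorial : ℝ)) •
      (((x:ℂ) * Complex.I)^(j+i) * Complex.exp (t * ((x:ℂ) * Complex.I)))) μ :=
    fun i _ => (cfd_int hμ (j+i) t).smul (h^i/(i.factorial : ℝ))
  rw [← integral_finsetSum _ hi,
    ← integral_sub (cfd_int hμ j (t+h)) (integrable_finsetSum _ hi),
    ← integral_const_mul]
  refine norm_integral_le_of_norm_le ((int_abs hμ (j+n)).const_mul _) (ae_of_all _ fun x => ?_)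
  have e : ((x:ℂ) * Complex.I)^j * Complex.exp ((t+h : ℝ) * ((x:ℂ) * Complex.I)) -
      ∑ i ∈ Finset.range n, (h^i/(i.factorial : ℝ)) •
        (((x:ℂ) * Complex.I)^(j+i) * Complex.exp (t * ((x:ℂ) * Complex.I)))
      = ((x:ℂ) * Complex.I)^j * Complex.exp (t * ((x:ℂ) * Complex.I)) *
        (Complex.exp (h * ((x:ℂ) * Complex.I)) -
          ∑ i ∈ Finset.range n, (h^i/(i.factorial : ℝ)) • ((x:ℂ) * Complex.I)^i) := by
    rw [mul_sub, Finset.mul_sum]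
    congr 1
    · rw [Complex.ofReal_add, add_mul, Complex.exp_add]; ring
    · apply Finset.sum_congr rfl
      intro i _
      rw [mul_smul_comm, pow_add]
      congr 1
      ring
  have := exp_taylor ((x:ℂ) * Complex.I) (by simp) n h hh
  rw [e, norm_mul, norm_mul, norm_pow, norm_cexp_aux, mul_one, norm_xI]
  rw [norm_xI] at this
  calc |x|^j * _ ≤ |x|^j * (h^n/(n.factorial : ℝ) * |x|^n) := by gcongr
    _ = _ := by ring

lemma abs_even (x : ℝ) (k : ℕ) : |x|^(2*k) = x^(2*k) := by
  rw [pow_mul, pow_mul, sq_abs]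

theorem carleman_det (μ ν : Measure ℝ) [IsProbabilityMeasure μ] [IsProbabilityMeasure ν]
    (hμ : ∀ k : ℕ, Integrable (fun x : ℝ => x^k) μ)
    (hν : ∀ k : ℕ, Integrable (fun x : ℝ => x^k) ν)
    (hmom : ∀ k : ℕ, ∫ x, x^k ∂μ = ∫ x, x^k ∂ν)
    (hpos : ∀ k : ℕ, 0 < ∫ x, x^(2*k) ∂ν)
    (hC : ¬ Summable (fun k : ℕ => (∫ x, x^(2*(k+1)) ∂ν) ^ (-(1 / (2 * ((k : ℝ) + 1)))))) :
    μ = ν := by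
  set M : ℕ → ℝ := fun n => ∫ x, |x|^n ∂μ + ∫ x, |x|^n ∂ν with hMdef
  have hM0 : ∀ n, 0 ≤ M n := fun n =>
    add_nonneg (integral_nonneg fun x => by positivity) (integral_nonneg fun x => by positivity)
  have hMe : ∀ k, M (2*k) = 2 * ∫ x, x^(2*k) ∂ν := by
    intro k
    simp only [hMdef, abs_even]
    rw [hmom]; ring
  have quad : ∀ {ρ : Measure ℝ}, (∀ k : ℕ, Integrable (fun x : ℝ => x^k) ρ) → ∀ (n : ℕ) (s : ℝ),
      0 ≤ (∫ x, |x|^n ∂ρ) * (s * s) + (-2 * ∫ x, |x|^(n+1) ∂ρ) * s + ∫ x, |x|^(n+2) ∂ρ := by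
    intro ρ hρ n s
    have e : (∫ x, |x|^n * (s - |x|)^2 ∂ρ) = (∫ x, |x|^n ∂ρ) * (s * s)
        + (-2 * ∫ x, |x|^(n+1) ∂ρ) * s + ∫ x, |x|^(n+2) ∂ρ := by
      have : (fun x : ℝ => |x|^n * (s - |x|)^2) =
          fun x => ((s*s) * |x|^n + (-2 * s) * |x|^(n+1)) + |x|^(n+2) := by
        funext x; ring
      have hi : Integrable (fun x : ℝ => (s*s) * |x|^n + (-2 * s) * |x|^(n+1)) ρ :=
        ((int_abs hρ n).const_mul _).add ((int_abs hρ (n+1)).const_mul _)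
      rw [this, integral_add hi
        (int_abs hρ (n+2)), integral_add ((int_abs hρ n).const_mul _) ((int_abs hρ (n+1)).const_mul _),
        integral_const_mul, integral_const_mul]
      ring
    rw [← e]
    exact integral_nonneg fun x => by positivity
  have hlc : ∀ n, M (n+1)^2 ≤ M n * M (n+2) := by
    intro n
    have := discrim_le_zero (a := M n) (b := -2 * M (n+1)) (c := M (n+2)) (fun s => by
      have h1 := quad hμ n s
      have h2 := quad hν n s
      simp only [hMdef]
      linarith)
    unfold discrim at this
    nlinarith
  have hM : ∀ n, 0 < M n := by
    have heven : ∀ k, 0 < M (2*k) := fun k => by rw [hMe]; linarith [hpos k]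
    intro n
    rcases Nat.even_or_odd' n with ⟨k, rfl | rfl⟩
    · exact heven k
    · have h1 := hlc (2*k+1)
      have h2 : 0 < M (2*k+1+1) := heven (k+1)
      rcases (hM0 (2*k+1)).eq_or_lt with h | h
      · rw [← h, zero_mul] at h1
        nlinarith
      · exact h
  have hdiv : ¬ Summable (fun n => M n / M (n+1)) := by
    intro hs
    have h1 := carleman_ineq _ (fun n => (div_pos (hM n) (hM (n+1))).le) hs
    have h2 := h1.comp_injective (i := fun k : ℕ => 2*k+1) (fun a b h => by simpa using h)
    apply hC
    refine h2.congr ?_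
    intro k
    simp only [Function.comp]
    have hp : ∀ n, ∏ i ∈ Finset.range n, M i / M (i+1) = M 0 / M n := by
      intro n
      induction n with
      | zero => simp [(hM 0).ne']
      | succ n ih =>
        rw [Finset.prod_range_succ, ih]
        have := (hM n).ne'
        field_simp
    rw [hp]
    have e0 : M 0 = 2 := by
      have := hMe 0
      simpa using this
    rw [e0, show 2*k+1+1 = 2*(k+1) by ring, hMe, Real.rpow_neg (hpos _).le,
      ← Real.inv_rpow (hpos _).le]
    have := (hpos (k+1)).ne'
    congr 1
    · field_simp
    · push_cast; ring
  have hF := bang_main (fun n t => cfd μ n t - cfd ν n t) M hM hlc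
    (fun n x => (norm_sub_le _ _).trans (add_le_add (cfd_bound n x) (cfd_bound n x)))
    (fun j n x h hh => by
      have h1 := cfd_taylor hμ j n x h hh
      have h2 := cfd_taylor hν j n x h hh
      have e : cfd μ j (x+h) - cfd ν j (x+h) -
          ∑ i ∈ Finset.range n, (h^i/(i.factorial : ℝ)) • (cfd μ (j+i) x - cfd ν (j+i) x)
          = (cfd μ j (x+h) - ∑ i ∈ Finset.range n, (h^i/(i.factorial : ℝ)) • cfd μ (j+i) x)
          - (cfd ν j (x+h) - ∑ i ∈ Finset.range n, (h^i/(i.factorial : ℝ)) • cfd ν (j+i) x) := by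
        simp_rw [smul_sub]
        rw [Finset.sum_sub_distrib]
        ring
      rw [e]
      refine (norm_sub_le _ _).trans ((add_le_add h1 h2).trans (le_of_eq ?_))
      simp only [hMdef]
      ring)
    (fun n => by
      have : ∀ ρ : Measure ℝ, cfd ρ n 0 = ((∫ x, x^n ∂ρ : ℝ) : ℂ) * Complex.I^n := by
        intro ρ
        unfold cfd
        rw [← integral_complex_ofReal, ← integral_mul_const]
        congr 1
        funext x
        simp [mul_pow]
      simp only [this, hmom, sub_self])
    hdiv
  have hcf : ∀ ρ : Measure ℝ, ∀ t : ℝ, cfd ρ 0 t = charFun ρ t := by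
    intro ρ t
    rw [charFun_apply_real]
    unfold cfd
    simp [mul_assoc]
  have hpos' : ∀ t, 0 ≤ t → charFun μ t = charFun ν t := by
    intro t ht
    have := hF t ht
    simp only [hcf] at this
    exact sub_eq_zero.mp this
  apply Measure.ext_of_charFun
  funext t
  rcases le_total 0 t with ht | ht
  · exact hpos' t ht
  · have := hpos' (-t) (by linarith)
    rw [charFun_neg, charFun_neg] at this
    exact (starRingEnd ℂ).injective this

lemma summable_of_count (u : ℕ → ℝ) (J : ℕ → ℕ) (hJ1 : ∀ k, 1 ≤ J k) (n0 : ℕ)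
    (hJ : ∀ k n : ℕ, n0 ≤ n → 2 * (k:ℝ) + 4 ≤ u n → J k ≤ n)
    (hu : ∀ n, n0 ≤ n → 0 ≤ u n)
    (hs : Summable (fun k => 1 / (J k : ℝ))) :
    Summable (fun n : ℕ => if n0 ≤ n then u n / (n:ℝ)^2 else 0) := by
  set g : ℕ × ℕ → ℝ := fun q => if J q.1 ≤ q.2 then ((q.2:ℝ)^2)⁻¹ else 0 with hg
  have hg0 : 0 ≤ g := by
    intro q
    simp only [hg, Pi.zero_apply]
    split_ifs <;> positivity
  have hpart : ∀ k N, ∑ n ∈ Finset.range N, g (k, n) ≤ 2 / (J k : ℝ) := by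
    intro k N
    have h1 := sum_Ioo_inv_sq_le (α := ℝ) (J k - 1) N
    have h2 : ((J k - 1 : ℕ) : ℝ) + 1 = J k := by
      have := hJ1 k
      push_cast [this]
      ring
    rw [h2] at h1
    refine le_trans (le_of_eq ?_) h1
    simp only [hg]
    rw [← Finset.sum_filter]
    apply Finset.sum_congr
    · ext n
      have := hJ1 k
      simp only [Finset.mem_filter, Finset.mem_range, Finset.mem_Ioo]
      omega
    · intros; rfl
  have hgs : Summable g := by
    rw [summable_prod_of_nonneg hg0]
    refine ⟨fun k => summable_of_sum_range_le (fun n => hg0 (k, n)) (hpart k), ?_⟩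
    refine Summable.of_nonneg_of_le (fun k => tsum_nonneg fun n => hg0 (k, n))
      (fun k => Real.tsum_le_of_sum_range_le (fun n => hg0 (k, n)) (hpart k)) ?_
    simpa [div_eq_mul_inv] using hs.mul_left 2
  have hgs' : Summable (fun q : ℕ × ℕ => g q.swap) := hgs.prod_symm
  have hg0' : (0 : ℕ × ℕ → ℝ) ≤ fun q : ℕ × ℕ => g q.swap := by
    intro q
    exact hg0 q.swap
  have hswap0 := (summable_prod_of_nonneg hg0').mp hgs'
  simp only [Prod.swap_prod_mk] at hswap0
  obtain ⟨hswap1, hswap2⟩ := hswap0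
  have hsq : Summable (fun n : ℕ => ((n:ℝ)^2)⁻¹) := Real.summable_nat_pow_inv.mpr (by norm_num)
  refine Summable.of_nonneg_of_le ?_ ?_ ((hsq.mul_left 4).add (hswap2.mul_left 2))
  · intro n
    split_ifs with h
    · exact div_nonneg (hu n h) (by positivity)
    · exact le_rfl
  · intro n
    have htn : 0 ≤ ∑' k, g (k, n) := tsum_nonneg fun k => hg0 (k, n)
    split_ifs with h
    · set K := ⌈(u n - 4) / 2⌉₊ with hK
      have h1 : (K:ℝ) * ((n:ℝ)^2)⁻¹ ≤ ∑' k, g (k, n) := by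
        have := (hswap1 n).sum_le_tsum (Finset.range K) (fun k _ => hg0 (k, n))
        refine le_trans (le_of_eq ?_) this
        rw [Finset.sum_congr rfl (g := fun _ => ((n:ℝ)^2)⁻¹)]
        · simp
        · intro k hk
          rw [Finset.mem_range, hK, Nat.lt_ceil] at hk
          simp only [hg]
          rw [if_pos]
          exact hJ k n h (by linarith)
      have h2 : (u n - 4) / 2 ≤ K := Nat.le_ceil _
      have h3 : 0 ≤ ((n:ℝ)^2)⁻¹ := by positivity
      have h4 := mul_le_mul_of_nonneg_right h2 h3
      rw [div_eq_mul_inv]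
      linarith
    · have : 0 ≤ ((n:ℝ)^2)⁻¹ := by positivity
      linarith

theorem carleman_cond (p : ℤ → ℝ) (j0 : ℤ) (hj0 : 2 ≤ j0)
    (hpos : ∀ j : ℤ, 0 < p j)
    (hsymm : ∀ j : ℤ, p (-j) = p j)
    (htotal : HasSum p 1)
    (hmom : ∀ k : ℕ, Summable (fun j : ℤ => (j : ℝ) ^ (2 * k) * p j))
    (hK : ¬ Summable (fun j : ℤ =>
        if j0 ≤ |j| then -Real.log (p j) / ((j : ℝ) ^ 2 * Real.log |(j : ℝ)|) else 0))
    (hu_mono : ∀ j j' : ℤ, j0 ≤ j → j ≤ j' →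
        -Real.log (p j) / Real.log (j : ℝ) ≤ -Real.log (p j') / Real.log (j' : ℝ))
    (hu_top : Tendsto (fun j : ℤ => -Real.log (p j) / Real.log (j : ℝ)) atTop atTop) :
    ¬ Summable (fun k : ℕ =>
        (∑' j : ℤ, (j : ℝ) ^ (2 * (k + 1)) * p j) ^ (-(1 / (2 * ((k : ℝ) + 1))))) := by
  intro hs
  apply hK
  obtain ⟨n0, rfl⟩ := Int.eq_ofNat_of_zero_le (by omega : 0 ≤ j0)
  have hn0 : 2 ≤ n0 := by exact_mod_cast hj0
  set u : ℕ → ℝ := fun n => -Real.log (p n) / Real.log (n:ℝ) with hu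
  have hmono : ∀ a b : ℕ, n0 ≤ a → a ≤ b → u a ≤ u b := by
    intro a b ha hab
    have := hu_mono a b (by exact_mod_cast ha) (by exact_mod_cast hab)
    simpa [hu] using this
  have htop : Tendsto u atTop atTop := by
    have := hu_top.comp tendsto_natCast_atTop_atTop
    refine this.congr ?_
    intro n
    simp [hu]
  have hp1 : ∀ j, p j ≤ 1 := fun j => le_hasSum htotal j (fun i _ => (hpos i).le)
  have hlogn : ∀ n, n0 ≤ n → 0 < Real.log (n:ℝ) := fun n hn =>
    Real.log_pos (by exact_mod_cast (by omega : 1 < n))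
  have hu0 : ∀ n, n0 ≤ n → 0 ≤ u n := by
    intro n hn
    refine div_nonneg ?_ (hlogn n hn).le
    rw [neg_nonneg]
    exact Real.log_nonpos (hpos _).le (hp1 _)
  have hex : ∀ k : ℕ, ∃ n, n0 ≤ n ∧ 2 * (k:ℝ) + 4 ≤ u n := fun k =>
    ((eventually_ge_atTop n0).and (htop.eventually_ge_atTop (2 * (k:ℝ) + 4))).exists
  classical
  set J : ℕ → ℕ := fun k => Nat.find (hex k) with hJdef
  have hJspec : ∀ k, n0 ≤ J k ∧ 2 * (k:ℝ) + 4 ≤ u (J k) := fun k => Nat.find_spec (hex k)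
  have hJle : ∀ k n : ℕ, n0 ≤ n → 2 * (k:ℝ) + 4 ≤ u n → J k ≤ n := fun k n h1 h2 =>
    Nat.find_min' (hex k) ⟨h1, h2⟩
  have hJ1 : ∀ k, 1 ≤ J k := fun k => by have := (hJspec k).1; omega
  -- pointwise bound
  have hpt : ∀ k n, J k ≤ n → (n:ℝ)^(2*(k+1)) * p n ≤ ((n:ℝ)^2)⁻¹ := by
    intro k n hn
    have hn' : n0 ≤ n := (hJspec k).1.trans hn
    have h1 : 2 * (k:ℝ) + 4 ≤ u n := (hJspec k).2.trans (hmono _ _ (hJspec k).1 hn)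
    have hnpos : (0:ℝ) < n := by exact_mod_cast (by omega : 0 < n)
    simp only [hu] at h1
    rw [le_div_iff₀ (hlogn n hn')] at h1
    have h2 : (n:ℝ)^(2*k+4) * p n ≤ 1 := by
      have hq : 0 < (n:ℝ)^(2*k+4) * p n := mul_pos (by positivity) (hpos _)
      rw [← Real.log_nonpos_iff hq.le, Real.log_mul (by positivity) (hpos _).ne', Real.log_pow]
      push_cast
      linarith
    rw [← one_div, le_div_iff₀ (by positivity)]
    refine le_trans (le_of_eq ?_) h2
    ring
  have hsqZ : Summable (fun j : ℤ => ((j:ℝ)^2)⁻¹) := by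
    simpa using (Real.summable_one_div_int_pow (p := 2)).mpr (by norm_num)
  set C := ∑' j : ℤ, ((j:ℝ)^2)⁻¹ with hC
  have hC0 : 0 ≤ C := tsum_nonneg fun j => by positivity
  have hmb : ∀ k, (∑' j : ℤ, (j : ℝ) ^ (2 * (k + 1)) * p j) ≤ ((1 + C) * J k)^(2*(k+1)) := by
    intro k
    have hJr : (1:ℝ) ≤ J k := by exact_mod_cast hJ1 k
    have hb : ∀ j : ℤ, (j : ℝ) ^ (2 * (k + 1)) * p j ≤ (J k : ℝ)^(2*(k+1)) * p j + ((j:ℝ)^2)⁻¹ := by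
      intro j
      have habs : (j : ℝ) ^ (2 * (k + 1)) = ((j.natAbs : ℕ) : ℝ)^(2*(k+1)) := by
        rw [pow_mul, pow_mul, Nat.cast_natAbs]
        push_cast
        rw [sq_abs]
      have habs2 : (j : ℝ) ^ 2 = ((j.natAbs : ℕ) : ℝ)^2 := by
        rw [Nat.cast_natAbs]
        push_cast
        rw [sq_abs]
      have hpj : p j = p (j.natAbs : ℤ) := by
        rcases Int.natAbs_eq j with h | h
        · rw [← h]
        · conv_lhs => rw [h]
          rw [hsymm]
      have hp := hpos (j.natAbs : ℤ)
      rw [habs, habs2, hpj]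
      rcases le_total (J k) j.natAbs with h | h
      · have := hpt k _ h
        have : 0 ≤ (J k : ℝ)^(2*(k+1)) * p (j.natAbs : ℤ) := by positivity
        linarith
      · have : ((j.natAbs : ℕ) : ℝ)^(2*(k+1)) ≤ (J k : ℝ)^(2*(k+1)) := by gcongr
        have h2 := mul_le_mul_of_nonneg_right this hp.le
        have : 0 ≤ (((j.natAbs : ℕ) : ℝ)^2)⁻¹ := by positivity
        linarith
    have hle := Summable.tsum_le_tsum hb (hmom (k+1)) ((htotal.summable.mul_left _).add hsqZ)
    rw [Summable.tsum_add (htotal.summable.mul_left _) hsqZ, tsum_mul_left, htotal.tsum_eq, mul_one,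
      ← hC] at hle
    have hJp : (1:ℝ) ≤ (J k : ℝ)^(2*(k+1)) := one_le_pow₀ hJr
    have hCp : 1 + C ≤ (1 + C)^(2*(k+1)) := le_self_pow₀ (by linarith) (by omega)
    rw [mul_pow]
    nlinarith
  have hmpos : ∀ k, 0 < ∑' j : ℤ, (j : ℝ) ^ (2 * (k + 1)) * p j := by
    intro k
    refine (hmom (k+1)).tsum_pos (fun j => mul_nonneg (by rw [pow_mul]; positivity) (hpos j).le) 1 ?_
    simpa using hpos 1
  have hJs : Summable (fun k => 1 / (J k : ℝ)) := by
    refine Summable.of_nonneg_of_le (fun k => by positivity) ?_ (hs.mul_left (1 + C))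
    intro k
    have hJr : (1:ℝ) ≤ J k := by exact_mod_cast hJ1 k
    have hb : (0:ℝ) < (1 + C) * J k := by positivity
    have h1 : (∑' j : ℤ, (j : ℝ) ^ (2 * (k + 1)) * p j) ^ (1 / (2 * ((k : ℝ) + 1))) ≤ (1 + C) * J k := by
      have := Real.rpow_le_rpow (hmpos k).le (hmb k) (by positivity : 0 ≤ 1 / (2 * ((k : ℝ) + 1)))
      refine this.trans (le_of_eq ?_)
      have h := Real.pow_rpow_inv_natCast (x := (1 + C) * J k) hb.le (by omega : 2*(k+1) ≠ 0)
      rw [← h]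
      congr 1
      · rw [h]
      · push_cast; rw [one_div]
    rw [Real.rpow_neg (hmpos k).le]
    have h2 := Real.rpow_pos_of_pos (hmpos k) (1 / (2 * ((k : ℝ) + 1)))
    have h3 : ((1 + C) * J k)⁻¹ ≤ ((∑' j : ℤ, (j : ℝ) ^ (2 * (k + 1)) * p j) ^ (1 / (2 * ((k : ℝ) + 1))))⁻¹ :=
      inv_anti₀ h2 h1
    calc 1 / (J k : ℝ) = (1 + C) * ((1 + C) * J k)⁻¹ := by field_simp
      _ ≤ _ := by gcongr
  have hfin := summable_of_count u J hJ1 n0 hJle hu0 hJs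
  have hterm : ∀ n : ℕ, (if n0 ≤ n then u n / (n:ℝ)^2 else 0) =
      if n0 ≤ n then -Real.log (p n) / ((n:ℝ)^2 * Real.log (n:ℝ)) else 0 := by
    intro n
    simp only [hu]
    rw [div_div, mul_comm]
  simp only [hterm] at hfin
  apply Summable.of_nat_of_neg
  · refine hfin.congr ?_
    intro n
    simp
  · refine hfin.congr ?_
    intro n
    simp [hsymm]

theorem stmt_7 (p : ℤ → ℝ) (j0 : ℤ) (hj0 : 2 ≤ j0)
    (hpos : ∀ j : ℤ, 0 < p j)
    (hsymm : ∀ j : ℤ, p (-j) = p j)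
    (htotal : HasSum p 1)
    (hmom : ∀ k : ℕ, Summable (fun j : ℤ => (j : ℝ) ^ (2 * k) * p j))
    -- condition (9)
    (hK : ¬ Summable (fun j : ℤ =>
        if j0 ≤ |j| then -Real.log (p j) / ((j : ℝ) ^ 2 * Real.log |(j : ℝ)|) else 0))
    -- condition (10)
    (hu_mono : ∀ j j' : ℤ, j0 ≤ j → j ≤ j' →
        -Real.log (p j) / Real.log (j : ℝ) ≤ -Real.log (p j') / Real.log (j' : ℝ))
    (hu_top : Tendsto (fun j : ℤ => -Real.log (p j) / Real.log (j : ℝ)) atTop atTop) :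
    -- Carleman's condition (Hamburger case)
    (¬ Summable (fun k : ℕ =>
        (∑' j : ℤ, (j : ℝ) ^ (2 * (k + 1)) * p j) ^ (-(1 / (2 * ((k : ℝ) + 1)))))) ∧
    -- moment determinacy
    (∀ μ : Measure ℝ, IsProbabilityMeasure μ →
        (∀ k : ℕ, ∫ x, x ^ k ∂μ = ∑' j : ℤ, (j : ℝ) ^ k * p j) →
        μ = Measure.sum (fun j : ℤ => ENNReal.ofReal (p j) • Measure.dirac (j : ℝ))) := by
  have hC := carleman_cond p j0 hj0 hpos hsymm htotal hmom hK hu_mono hu_top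
  refine ⟨hC, ?_⟩
  intro μ hμp hμm
  set ν := Measure.sum (fun j : ℤ => ENNReal.ofReal (p j) • Measure.dirac (j : ℝ)) with hν
  have hxk : ∀ (k : ℕ) (x : ℝ), ‖x^k‖ ≤ 1 + x^(2*k) := by
    intro k x
    rw [norm_pow, Real.norm_eq_abs, ← abs_even, mul_comm 2 k, pow_mul]
    nlinarith [sq_nonneg (|x|^k - 1), pow_nonneg (abs_nonneg x) k]
  have htr : ∀ j, (ENNReal.ofReal (p j)).toReal = p j := fun j => ENNReal.toReal_ofReal (hpos j).le
  have hsumk : ∀ k : ℕ, Summable (fun j : ℤ => (ENNReal.ofReal (p j)).toReal * ‖((j:ℝ))^k‖) := by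
    intro k
    refine Summable.of_nonneg_of_le (fun j => by positivity) ?_ (htotal.summable.add (hmom k))
    intro j
    rw [htr]
    have := mul_le_mul_of_nonneg_left (hxk k j) (hpos j).le
    linarith
  have hνint : ∀ k : ℕ, Integrable (fun x : ℝ => x^k) ν := fun k =>
    integrable_sum_dirac (fun i => ENNReal.ofReal_ne_top) (hsumk k)
  have hνm : ∀ k : ℕ, ∫ x, x^k ∂ν = ∑' j : ℤ, (j : ℝ) ^ k * p j := by
    intro k
    rw [hν, integral_sum_dirac_eq_tsum (f := fun x : ℝ => x^k) (fun i => ENNReal.ofReal_ne_top) (hsumk k)]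
    congr 1
    funext j
    rw [htr, smul_eq_mul, mul_comm]
  have hmpos : ∀ k : ℕ, 0 < ∑' j : ℤ, (j : ℝ) ^ (2 * k) * p j := by
    intro k
    refine (hmom k).tsum_pos (fun j => mul_nonneg (by rw [pow_mul]; positivity) (hpos j).le) 1 ?_
    simpa using hpos 1
  have hμint : ∀ k : ℕ, Integrable (fun x : ℝ => x^k) μ := by
    intro k
    have he : Integrable (fun x : ℝ => x^(2*k)) μ := by
      by_contra h
      have h1 := hμm (2*k)
      rw [integral_undef h] at h1
      exact (hmpos k).ne h1
    exact ((integrable_const 1).add he).mono' (by fun_prop) (ae_of_all _ fun x => hxk k x)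
  have : IsProbabilityMeasure ν := by
    constructor
    rw [hν, Measure.sum_apply _ MeasurableSet.univ]
    simp only [Measure.smul_apply, measure_univ, smul_eq_mul, mul_one]
    rw [← ENNReal.ofReal_tsum_of_nonneg (fun j => (hpos j).le) htotal.summable, htotal.tsum_eq,
      ENNReal.ofReal_one]
  apply carleman_det μ ν hμint hνint
  · intro k; rw [hμm, hνm]
  · intro k; rw [hνm]; exact hmpos k
  · simpa only [hνm] using hC
end

section
/- Let Y ≥ 0 have density g(x) = exp(-u(x) ln x) on (0,∞) satisfying Carleman's condition, and let v be a measurable function with v(x) ≥ u(x) for x ≥ a > 1. If Y* has density g*(x) = c*·exp(-v(x) ln x) (c* > 0 normalizing constant), then E[Y*^n] ≤ c̃ · E[Y^n] for all n ≥ 1 for some constant c̃ > 0 independent of n, hence Y* also satisfies the Stieltjes Carleman condition and is moment-determinate. -/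
open Filter Set MeasureTheory

/-- Sharp Taylor bound for the complex exponential on the imaginary axis, nonnegative case. -/
lemma carl_exp_taylor_nonneg (n : ℕ) : ∀ x : ℝ, 0 ≤ x →
    ‖Complex.exp (Complex.I * x) - ∑ i ∈ Finset.range n, (Complex.I * x) ^ i / (i.factorial : ℂ)‖
      ≤ x ^ n / (n.factorial : ℝ) := by
  induction n with
  | zero => intro x hx; simp [mul_comm Complex.I, Complex.norm_exp_ofReal_mul_I]
  | succ n ih =>
    intro x hx
    have hd : ∀ y : ℝ, HasDerivAt (fun y : ℝ => Complex.exp (Complex.I * y)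
        - ∑ i ∈ Finset.range (n+1), (Complex.I * y) ^ i / (i.factorial : ℂ))
        (Complex.I * (Complex.exp (Complex.I * y)
        - ∑ i ∈ Finset.range n, (Complex.I * y) ^ i / (i.factorial : ℂ))) y := by
      intro y
      have h0 : HasDerivAt (fun y : ℝ => Complex.I * (y:ℂ)) Complex.I y := by
        simpa using (Complex.ofRealCLM.hasDerivAt (x := y)).const_mul Complex.I
      have h1 := h0.cexp
      have h2 : HasDerivAt (fun y : ℝ => ∑ i ∈ Finset.range (n+1),
          (Complex.I * (y:ℂ)) ^ i / (i.factorial : ℂ))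
          (∑ i ∈ Finset.range (n+1), ((i:ℂ) * (Complex.I * (y:ℂ)) ^ (i-1) * Complex.I) / (i.factorial : ℂ)) y := by
        apply HasDerivAt.fun_sum
        intro i _
        exact (h0.pow i).div_const _
      refine (h1.sub h2).congr_deriv (Eq.symm ?_)
      rw [Finset.sum_range_succ']
      simp only [Nat.add_sub_cancel, Nat.cast_zero, zero_mul, zero_div, add_zero]
      rw [mul_sub, Finset.mul_sum, mul_comm Complex.I]
      congr 1
      apply Finset.sum_congr rfl
      intro i _
      rw [Nat.factorial_succ]
      have : (i.factorial : ℂ) ≠ 0 := by exact_mod_cast i.factorial_ne_zero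
      have : ((i:ℂ) + 1) ≠ 0 := by exact_mod_cast i.succ_ne_zero
      push_cast
      field_simp
    have key := image_norm_le_of_norm_deriv_right_le_deriv_boundary (a := 0) (b := x)
      (f := fun y : ℝ => Complex.exp (Complex.I * y)
        - ∑ i ∈ Finset.range (n+1), (Complex.I * y) ^ i / (i.factorial : ℂ))
      (f' := fun y : ℝ => Complex.I * (Complex.exp (Complex.I * y)
        - ∑ i ∈ Finset.range n, (Complex.I * y) ^ i / (i.factorial : ℂ)))
      (B := fun y => y ^ (n+1) / ((n+1).factorial : ℝ))
      (B' := fun y => y ^ n / (n.factorial : ℝ))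
      (fun y _ => (hd y).continuousAt.continuousWithinAt)
      (fun y _ => (hd y).hasDerivWithinAt)
      (by simp [Finset.sum_range_succ'])
      (by
        intro y
        have := (hasDerivAt_pow (n+1) y).div_const ((n+1).factorial : ℝ)
        refine this.congr_deriv (Eq.symm ?_)
        rw [Nat.factorial_succ]
        have : (n.factorial : ℝ) ≠ 0 := by exact_mod_cast n.factorial_ne_zero
        have : ((n:ℝ) + 1) ≠ 0 := by exact_mod_cast n.succ_ne_zero
        push_cast
        field_simp
        try simp)
      (by
        intro y hy
        rw [norm_mul, Complex.norm_I, one_mul]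
        exact ih y hy.1)
    exact key (right_mem_Icc.2 hx)

lemma carl_exp_taylor (n : ℕ) (x : ℝ) :
    ‖Complex.exp (Complex.I * x) - ∑ i ∈ Finset.range n, (Complex.I * x) ^ i / (i.factorial : ℂ)‖
      ≤ |x| ^ n / (n.factorial : ℝ) := by
  rcases le_total 0 x with hx | hx
  · rw [abs_of_nonneg hx]; exact carl_exp_taylor_nonneg n x hx
  · rw [abs_of_nonpos hx]
    have := carl_exp_taylor_nonneg n (-x) (by linarith)
    rw [← Complex.norm_conj]
    convert this using 2
    simp [map_sum, ← Complex.exp_conj]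

/-- Bang's argument (Denjoy–Carleman quasi-analyticity). -/
lemma carl_bang (F : ℕ → ℝ → ℂ) (M : ℕ → ℝ) (hM : ∀ j, 0 < M j)
    (hlog : Antitone (fun k => M k / M (k+1)))
    (hT : ∀ j n s h, 0 ≤ h → ‖F j (s + h)‖ ≤
      ∑ i ∈ Finset.range n, ‖F (j+i) s‖ * h ^ i / (i.factorial : ℝ)
        + M (j+n) * h ^ n / (n.factorial : ℝ))
    (h0 : ∀ j, F j 0 = 0)
    (hns : ¬ Summable (fun k => M k / M (k+1))) (j : ℕ) (s : ℝ) (hs : 0 ≤ s) : F j s = 0 := by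
  set a : ℕ → ℝ := fun k => M k / M (k+1) with ha
  have ha0 : ∀ k, 0 < a k := fun k => div_pos (hM _) (hM _)
  have hb : ∀ j s, ‖F j s‖ ≤ M j := by
    intro j s
    simpa using hT j 0 s 0 le_rfl
  have hma : ∀ k, M (k+1) * a k = M k := by
    intro k; simp only [ha]; have := (hM (k+1)).ne'; field_simp
  have hMpow : ∀ N j i, j + i ≤ N + 1 → M (j+i) * a N ^ i ≤ M j := by
    intro N j i
    induction i with
    | zero => simp
    | succ i ih =>
      intro h
      have h1 := ih (by omega)
      have h2 : a N ≤ a (j+i) := hlog (by omega)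
      calc M (j+(i+1)) * a N ^ (i+1) = (M (j+i+1) * a N) * a N ^ i := by rw [← add_assoc]; ring
        _ ≤ (M (j+i+1) * a (j+i)) * a N ^ i := by
            have := (hM (j+i+1)).le
            have := (ha0 N).le
            gcongr
        _ = M (j+i) * a N ^ i := by rw [hma]
        _ ≤ M j := h1
  have step : ∀ N s h, 0 ≤ h → Real.exp 1 * h ≤ a N →
      (∀ j, ‖F j s‖ ≤ Real.exp ((j:ℝ) - (N+1 : ℕ)) * M j) →
      ∀ j, ‖F j (s+h)‖ ≤ Real.exp ((j:ℝ) - N) * M j := by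
    intro N s h hh hha hP j
    by_cases hj : N ≤ j
    · refine (hb j _).trans ?_
      have : (1:ℝ) ≤ Real.exp ((j:ℝ) - N) := by
        apply Real.one_le_exp
        have : (N:ℝ) ≤ j := by exact_mod_cast hj
        linarith
      nlinarith [hM j]
    · push Not at hj
      obtain ⟨n, hn⟩ : ∃ n, j + n = N + 1 := ⟨N+1-j, by omega⟩
      have hterm : ∀ i, j + i ≤ N + 1 →
          Real.exp (((j+i:ℕ):ℝ) - (N+1:ℕ)) * M (j+i) * h ^ i / (i.factorial : ℝ)
          ≤ Real.exp ((j:ℝ) - (N+1:ℕ)) * M j * ((1:ℝ) ^ i / (i.factorial : ℝ)) := by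
        intro i hi
        have e1 : Real.exp (((j+i:ℕ):ℝ) - (N+1:ℕ)) = Real.exp ((j:ℝ) - (N+1:ℕ)) * Real.exp 1 ^ i := by
          rw [← Real.exp_nat_mul, ← Real.exp_add]; congr 1; push_cast; ring
        have e2 : (Real.exp 1 * h) ^ i ≤ a N ^ i := by gcongr
        have e3 : M (j+i) * (Real.exp 1 * h) ^ i ≤ M j :=
          (mul_le_mul_of_nonneg_left e2 (hM _).le).trans (hMpow N j i hi)
        rw [e1]
        calc _ = Real.exp ((j:ℝ) - (N+1:ℕ)) * (M (j+i) * (Real.exp 1 * h) ^ i) * ((1:ℝ)^i / (i.factorial : ℝ)) := by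
              rw [mul_pow, one_pow]; ring
          _ ≤ _ := by gcongr
      calc ‖F j (s+h)‖ ≤ _ := hT j n s h hh
        _ ≤ ∑ i ∈ Finset.range n, Real.exp ((j:ℝ) - (N+1:ℕ)) * M j * ((1:ℝ) ^ i / (i.factorial : ℝ))
            + Real.exp ((j:ℝ) - (N+1:ℕ)) * M j * ((1:ℝ) ^ n / (n.factorial : ℝ)) := by
            apply add_le_add
            · apply Finset.sum_le_sum
              intro i hi
              have hi' := Finset.mem_range.1 hi
              refine le_trans ?_ (hterm i (by omega))
              gcongr
              exact hP _
            · have := hterm n hn.le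
              rw [hn] at this
              rw [hn]
              simpa using this
        _ = Real.exp ((j:ℝ) - (N+1:ℕ)) * M j * ∑ i ∈ Finset.range (n+1), ((1:ℝ) ^ i / (i.factorial : ℝ)) := by
            rw [← Finset.mul_sum, ← mul_add, Finset.sum_range_succ]
        _ ≤ Real.exp ((j:ℝ) - (N+1:ℕ)) * M j * Real.exp 1 := by
            have := (hM j).le
            gcongr
            exact Real.sum_le_exp_of_nonneg zero_le_one _
        _ = Real.exp ((j:ℝ) - N) * M j := by
            rw [mul_right_comm, ← Real.exp_add]; congr 2; push_cast; ring
  have desc : ∀ m N s, 0 ≤ s → Real.exp 1 * s ≤ ∑ k ∈ Finset.range m, a (N + k) →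
      ∀ j, ‖F j s‖ ≤ Real.exp ((j:ℝ) - N) * M j := by
    intro m
    induction m with
    | zero =>
      intro N s hs h j
      have : s = 0 := by
        simp at h
        have := Real.exp_pos 1
        nlinarith
      rw [this, h0, norm_zero]
      have := (hM j).le
      positivity
    | succ m ih =>
      intro N s hs h
      rw [Finset.sum_range_succ'] at h
      set S := ∑ k ∈ Finset.range m, a (N + (k+1)) with hS
      have hS0 : 0 ≤ S := Finset.sum_nonneg fun k _ => (ha0 _).le
      have hSe : S = ∑ k ∈ Finset.range m, a (N + 1 + k) := by
        apply Finset.sum_congr rfl; intro k _; congr 1; omega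
      have hE := Real.exp_pos 1
      set s' := min s (S / Real.exp 1) with hs'
      have h1 : 0 ≤ s' := le_min hs (by positivity)
      have h2 : Real.exp 1 * s' ≤ S := by
        have : s' ≤ S / Real.exp 1 := min_le_right _ _
        rw [le_div_iff₀ hE] at this; linarith
      have h3 : s' ≤ s := min_le_left _ _
      have := step N s' (s - s') (by linarith) (by
        rcases min_choice s (S / Real.exp 1) with h' | h'
        · rw [hs', h']; simpa using (ha0 N).le
        · rw [hs', h', mul_sub, mul_div_cancel₀ _ hE.ne']; simp at h; linarith)
        (ih (N+1) s' h1 (hSe ▸ h2))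
      simpa using this
  have all : ∀ N : ℕ, ‖F j s‖ ≤ Real.exp ((j:ℝ) - N) * M j := by
    intro N
    have hns' : ¬ Summable (fun k => a (N + k)) := by
      intro h
      apply hns
      rw [← summable_nat_add_iff N]
      simpa [add_comm] using h
    have ht := (not_summable_iff_tendsto_nat_atTop_of_nonneg (fun k => (ha0 (N+k)).le)).1 hns'
    obtain ⟨m, hm⟩ := (ht.eventually_ge_atTop (Real.exp 1 * s)).exists
    exact desc m N s hs hm j
  have lim : Tendsto (fun N : ℕ => Real.exp ((j:ℝ) - N) * M j) atTop (nhds (0 * M j)) := by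
    apply Tendsto.mul_const
    apply Real.tendsto_exp_atBot.comp
    have : Tendsto (fun N : ℕ => -(N:ℝ)) atTop atBot :=
      tendsto_neg_atTop_atBot.comp tendsto_natCast_atTop_atTop
    simpa [sub_eq_add_neg] using tendsto_atBot_add_const_left atTop (j:ℝ) this
  rw [zero_mul] at lim
  have := ge_of_tendsto' lim all
  exact norm_le_zero_iff.1 this

/-- Carleman's inequality (qualitative). -/
lemma carl_ineq (a : ℕ → ℝ) (ha : ∀ k, 0 ≤ a k) (hs : Summable a) :
    Summable (fun n : ℕ => (∏ k ∈ Finset.range (n+1), a k) ^ (((n:ℝ)+1)⁻¹)) := by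
  set S : ℕ → ℝ := fun n => ∑ k ∈ Finset.range n, ((k:ℝ)+1) * a k with hSdef
  have hS0 : ∀ n, 0 ≤ S n := fun n => Finset.sum_nonneg fun k _ => mul_nonneg (by positivity) (ha k)
  have hgm : ∀ n : ℕ, (∏ k ∈ Finset.range (n+1), a k) ^ (((n:ℝ)+1)⁻¹)
      ≤ Real.exp 1 * (S (n+1) / ((n:ℝ)+1)^2) := by
    intro n
    have h1 := Real.geom_mean_le_arith_mean (Finset.range (n+1)) (fun _ => 1)
      (fun k => ((k:ℝ)+1) * a k) (fun _ _ => zero_le_one) (by simp; positivity)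
      (fun k _ => mul_nonneg (by positivity) (ha k))
    simp only [Real.rpow_one, one_mul, Finset.sum_const, Finset.card_range, nsmul_eq_mul, mul_one,
      Finset.prod_mul_distrib] at h1
    have hP : 0 ≤ ∏ k ∈ Finset.range (n+1), a k := Finset.prod_nonneg fun k _ => ha k
    have hfac : ∏ k ∈ Finset.range (n+1), ((k:ℝ)+1) = ((n+1).factorial : ℝ) := by
      rw [← Finset.prod_range_add_one_eq_factorial]; push_cast; rfl
    rw [hfac, Real.mul_rpow (by positivity) hP] at h1
    push_cast at h1
    have h2 : ((n:ℝ)+1) / Real.exp 1 ≤ (((n+1).factorial : ℝ)) ^ (((n:ℝ)+1)⁻¹) := by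
      rw [Real.le_rpow_inv_iff_of_pos (by positivity) (by positivity) (by positivity)]
      have := Real.pow_div_factorial_le_exp (x := (n:ℝ)+1) (by positivity) (n+1)
      have e : ((n:ℝ)+1) = ((n+1:ℕ):ℝ) := by push_cast; rfl
      rw [e, Real.rpow_natCast, ← e, div_pow, ← Real.exp_nat_mul]
      rw [div_le_iff₀ (by positivity)] at this ⊢
      simpa [mul_comm] using this
    have h3 : 0 ≤ (∏ k ∈ Finset.range (n+1), a k) ^ (((n:ℝ)+1)⁻¹) := Real.rpow_nonneg hP _
    have h4 := (mul_le_mul_of_nonneg_right h2 h3).trans h1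
    have hE := Real.exp_pos 1
    have hn : (0:ℝ) < (n:ℝ)+1 := by positivity
    calc (∏ k ∈ Finset.range (n+1), a k) ^ (((n:ℝ)+1)⁻¹)
        = Real.exp 1 / ((n:ℝ)+1) * (((n:ℝ)+1) / Real.exp 1 * (∏ k ∈ Finset.range (n+1), a k) ^ (((n:ℝ)+1)⁻¹)) := by
          field_simp
      _ ≤ Real.exp 1 / ((n:ℝ)+1) * (S (n+1) / ((n:ℝ)+1)) := by gcongr
      _ = _ := by field_simp
  refine Summable.of_nonneg_of_le
    (fun n => Real.rpow_nonneg (Finset.prod_nonneg fun k _ => ha k) _) hgm ?_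
  apply Summable.mul_left
  have hind : ∀ L : ℕ, ∑ n ∈ Finset.range L, S (n+1) / ((n:ℝ)+1)^2 + S L / L
      ≤ 2 * ∑ k ∈ Finset.range L, a k := by
    intro L
    induction L with
    | zero => simp
    | succ L ih =>
      rw [Finset.sum_range_succ, Finset.sum_range_succ, mul_add]
      have hSs : S (L+1) = S L + ((L:ℝ)+1) * a L := by
        simp only [hSdef]; rw [Finset.sum_range_succ]
      have hL : (0:ℝ) < (L:ℝ)+1 := by positivity
      have k1 : S L * (1/((L:ℝ)+1)^2 + 1/((L:ℝ)+1)) ≤ S L / L := by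
        rcases Nat.eq_zero_or_pos L with h | h
        · subst h; simp [hSdef]
        · have hL' : (0:ℝ) < L := by exact_mod_cast h
          rw [div_eq_mul_one_div (S L)]
          apply mul_le_mul_of_nonneg_left _ (hS0 L)
          rw [div_add_div _ _ (by positivity) (by positivity), div_le_div_iff₀ (by positivity) (by positivity)]
          nlinarith [sq_nonneg ((L:ℝ)+1)]
      have k2 : ((L:ℝ)+1) * a L * (1/((L:ℝ)+1)^2 + 1/((L:ℝ)+1)) ≤ 2 * a L := by
        have : ((L:ℝ)+1) * a L * (1/((L:ℝ)+1)^2 + 1/((L:ℝ)+1)) = (1/((L:ℝ)+1) + 1) * a L := by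
          field_simp
        rw [this]
        apply mul_le_mul_of_nonneg_right _ (ha L)
        have : 1/((L:ℝ)+1) ≤ 1 := by rw [div_le_one hL]; linarith [(Nat.cast_nonneg L : (0:ℝ) ≤ L)]
        linarith
      have k3 : S (L+1) / ((L:ℝ)+1)^2 + S (L+1) / ((L+1:ℕ):ℝ)
          = S L * (1/((L:ℝ)+1)^2 + 1/((L:ℝ)+1)) + ((L:ℝ)+1) * a L * (1/((L:ℝ)+1)^2 + 1/((L:ℝ)+1)) := by
        rw [hSs]; push_cast; ring
      linarith
  apply summable_of_sum_range_le (c := 2 * ∑' k, a k)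
  · intro n; exact div_nonneg (hS0 _) (by positivity)
  · intro L
    have h1 := hind L
    have h2 : 0 ≤ S L / L := div_nonneg (hS0 _) (by positivity)
    have h3 := hs.sum_le_tsum (Finset.range L) (fun k _ => ha k)
    linarith

/-- Derivative-type transforms of the characteristic function. -/
noncomputable def carlF (ν : Measure ℝ) (j : ℕ) (s : ℝ) : ℂ :=
  ∫ x : ℝ, (Complex.I * x) ^ j * Complex.exp (Complex.I * (s * x : ℝ)) ∂ν

lemma carl_integrable (ν : Measure ℝ) (hν : ∀ n : ℕ, Integrable (fun x : ℝ => |x| ^ n) ν)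
    (j : ℕ) (s : ℝ) :
    Integrable (fun x : ℝ => (Complex.I * x) ^ j * Complex.exp (Complex.I * (s * x : ℝ))) ν := by
  refine (hν j).mono' (Continuous.aestronglyMeasurable (by fun_prop)) (ae_of_all _ fun x => ?_)
  rw [norm_mul, mul_comm Complex.I (((s * x : ℝ)) : ℂ), Complex.norm_exp_ofReal_mul_I]
  simp

lemma carl_taylor_meas (ν : Measure ℝ) (hν : ∀ n : ℕ, Integrable (fun x : ℝ => |x| ^ n) ν)
    (j n : ℕ) (s h : ℝ) (hh : 0 ≤ h) :
    ‖carlF ν j (s + h) - ∑ i ∈ Finset.range n, carlF ν (j+i) s * ((h ^ i / (i.factorial : ℝ) : ℝ) : ℂ)‖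
      ≤ (∫ x, |x| ^ (j+n) ∂ν) * h ^ n / (n.factorial : ℝ) := by
  unfold carlF
  have e : (∫ x : ℝ, (Complex.I * x) ^ j * Complex.exp (Complex.I * ((s+h) * x : ℝ)) ∂ν)
      - ∑ i ∈ Finset.range n, (∫ x : ℝ, (Complex.I * x) ^ (j+i) * Complex.exp (Complex.I * (s * x : ℝ)) ∂ν)
        * ((h ^ i / (i.factorial : ℝ) : ℝ) : ℂ)
      = ∫ x : ℝ, (Complex.I * x) ^ j * Complex.exp (Complex.I * (s * x : ℝ)) *
        (Complex.exp (Complex.I * (h * x : ℝ))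
          - ∑ i ∈ Finset.range n, (Complex.I * (h * x : ℝ)) ^ i / (i.factorial : ℂ)) ∂ν := by
    simp_rw [← integral_mul_const]
    rw [← integral_finsetSum _ (fun i _ => (carl_integrable ν hν _ _).mul_const _),
      ← integral_sub (carl_integrable ν hν _ _)
        (integrable_finsetSum _ (fun i _ => (carl_integrable ν hν _ _).mul_const _))]
    congr 1
    ext x
    rw [mul_sub, Finset.mul_sum]
    congr 1
    · rw [mul_assoc, ← Complex.exp_add]; congr 2; push_cast; ring
    · apply Finset.sum_congr rfl
      intro i _
      push_cast
      rw [mul_pow Complex.I ((h:ℂ) * x), mul_pow (h:ℂ), pow_add, mul_pow, mul_pow]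
      ring
  rw [e]
  have : (∫ x, |x| ^ (j+n) ∂ν) * h ^ n / (n.factorial : ℝ)
      = ∫ x, |x| ^ (j+n) * (h ^ n / (n.factorial : ℝ)) ∂ν := by
    rw [integral_mul_const]; ring
  rw [this]
  apply norm_integral_le_of_norm_le ((hν (j+n)).mul_const _)
  refine ae_of_all _ fun x => ?_
  rw [norm_mul, norm_mul, mul_comm Complex.I (((s * x : ℝ)) : ℂ), Complex.norm_exp_ofReal_mul_I]
  have h1 := carl_exp_taylor n (h * x)
  rw [abs_mul, abs_of_nonneg hh, mul_pow] at h1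
  have h2 : ‖(Complex.I * (x:ℂ)) ^ j‖ = |x| ^ j := by simp
  rw [h2, mul_one, pow_add]
  calc _ ≤ |x| ^ j * (h ^ n * |x| ^ n / (n.factorial : ℝ)) := by gcongr
    _ = _ := by ring

/-- Hamburger-type determinacy. -/
lemma carl_hamburger (ν₁ ν₂ : Measure ℝ) [IsFiniteMeasure ν₁] [IsFiniteMeasure ν₂]
    (h₁ : ∀ n : ℕ, Integrable (fun x : ℝ => |x| ^ n) ν₁)
    (h₂ : ∀ n : ℕ, Integrable (fun x : ℝ => |x| ^ n) ν₂)
    (hm : ∀ n : ℕ, ∫ x, x ^ n ∂ν₁ = ∫ x, x ^ n ∂ν₂)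
    (M : ℕ → ℝ) (hMdef : ∀ n, M n = ∫ x, |x| ^ n ∂ν₁ + ∫ x, |x| ^ n ∂ν₂)
    (hM : ∀ n, 0 < M n)
    (hc : ¬ Summable (fun n : ℕ => (M 0 / M (n+1)) ^ (((n:ℝ)+1)⁻¹))) : ν₁ = ν₂ := by
  have hquad : ∀ (ν : Measure ℝ), (∀ n : ℕ, Integrable (fun x : ℝ => |x| ^ n) ν) → ∀ k (t : ℝ),
      0 ≤ (∫ x, |x| ^ k ∂ν) * (t*t) + (-2 * ∫ x, |x| ^ (k+1) ∂ν) * t + ∫ x, |x| ^ (k+2) ∂ν := by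
    intro ν hν k t
    have : (∫ x, |x| ^ k ∂ν) * (t*t) + (-2 * ∫ x, |x| ^ (k+1) ∂ν) * t + ∫ x, |x| ^ (k+2) ∂ν
        = ∫ x, (|x| ^ k * (t*t) + |x| ^ (k+1) * (-2 * t) + |x| ^ (k+2)) ∂ν := by
      have i12 : Integrable (fun x : ℝ => |x| ^ k * (t*t) + |x| ^ (k+1) * (-2 * t)) ν :=
        ((hν _).mul_const _).add ((hν _).mul_const _)
      rw [integral_add i12 (hν _),
        integral_add ((hν _).mul_const _) ((hν _).mul_const _), integral_mul_const,
        integral_mul_const]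
      ring
    rw [this]
    apply integral_nonneg
    intro x
    have : |x| ^ k * (t*t) + |x| ^ (k+1) * (-2 * t) + |x| ^ (k+2) = |x| ^ k * (t - |x|)^2 := by ring
    simp only [Pi.zero_apply]
    rw [this]
    positivity
  have hlc : ∀ k, M (k+1) * M (k+1) ≤ M k * M (k+2) := by
    intro k
    have := discrim_le_zero (a := M k) (b := -2 * M (k+1)) (c := M (k+2)) (by
      intro t
      have a1 := hquad ν₁ h₁ k t
      have a2 := hquad ν₂ h₂ k t
      rw [hMdef, hMdef, hMdef]
      linarith)
    unfold discrim at this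
    nlinarith
  have hanti : Antitone (fun k => M k / M (k+1)) := by
    apply antitone_nat_of_succ_le
    intro k
    rw [div_le_div_iff₀ (hM _) (hM _)]
    exact hlc k
  have hns : ¬ Summable (fun k => M k / M (k+1)) := by
    intro hs
    apply hc
    have := carl_ineq _ (fun k => (div_pos (hM k) (hM (k+1))).le) hs
    convert this using 3 with n
    have hprod : ∀ n, ∏ k ∈ Finset.range n, M k / M (k+1) = M 0 / M n := by
      intro n
      induction n with
      | zero => simp [(hM 0).ne']
      | succ n ih =>
        rw [Finset.prod_range_succ, ih]
        have := (hM n).ne'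
        have := (hM (n+1)).ne'
        field_simp
    rw [hprod]
  have hz : ∀ s, 0 ≤ s → carlF ν₁ 0 s - carlF ν₂ 0 s = 0 := by
    intro s hs
    refine carl_bang (fun j s => carlF ν₁ j s - carlF ν₂ j s) M hM hanti ?_ ?_ hns 0 s hs
    · intro j n s h hh
      have t1 := carl_taylor_meas ν₁ h₁ j n s h hh
      have t2 := carl_taylor_meas ν₂ h₂ j n s h hh
      set A₁ := ∑ i ∈ Finset.range n, carlF ν₁ (j+i) s * ((h ^ i / (i.factorial : ℝ) : ℝ) : ℂ) with hA₁
      set A₂ := ∑ i ∈ Finset.range n, carlF ν₂ (j+i) s * ((h ^ i / (i.factorial : ℝ) : ℝ) : ℂ) with hA₂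
      have t3 : ‖A₁ - A₂‖ ≤ ∑ i ∈ Finset.range n,
          ‖carlF ν₁ (j+i) s - carlF ν₂ (j+i) s‖ * h ^ i / (i.factorial : ℝ) := by
        rw [hA₁, hA₂, ← Finset.sum_sub_distrib]
        apply norm_sum_le_of_le
        intro i _
        rw [← sub_mul, norm_mul, Complex.norm_real, Real.norm_of_nonneg (by positivity), mul_div_assoc]
      have e : carlF ν₁ j (s+h) - carlF ν₂ j (s+h)
          = (A₁ - A₂) + ((carlF ν₁ j (s+h) - A₁) - (carlF ν₂ j (s+h) - A₂)) := by ring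
      have t4 : ‖carlF ν₁ j (s+h) - carlF ν₂ j (s+h)‖ ≤ ‖A₁ - A₂‖
          + (‖carlF ν₁ j (s+h) - A₁‖ + ‖carlF ν₂ j (s+h) - A₂‖) := by
        rw [e]
        exact (norm_add_le _ _).trans (add_le_add le_rfl (norm_sub_le _ _))
      have e2 : M (j+n) * h ^ n / (n.factorial : ℝ)
          = (∫ x, |x| ^ (j+n) ∂ν₁) * h ^ n / (n.factorial : ℝ)
            + (∫ x, |x| ^ (j+n) ∂ν₂) * h ^ n / (n.factorial : ℝ) := by
        rw [hMdef]; ring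
      rw [e2]
      linarith
    · intro j
      have : ∀ ν : Measure ℝ, carlF ν j 0 = Complex.I ^ j * ((∫ x, x ^ j ∂ν : ℝ) : ℂ) := by
        intro ν
        unfold carlF
        rw [← integral_complex_ofReal, ← integral_const_mul]
        congr 1
        ext x
        simp [mul_pow]
      simp only [this, hm, sub_self]
  have hcf : ∀ (ν : Measure ℝ) s, charFun ν s = carlF ν 0 s := by
    intro ν s
    rw [charFun_apply_real]
    unfold carlF
    congr 1
    ext x
    rw [pow_zero, one_mul]
    congr 1
    push_cast
    ring
  apply Measure.ext_of_charFun
  ext s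
  rcases le_total 0 s with hs | hs
  · rw [hcf, hcf]; exact sub_eq_zero.1 (hz s hs)
  · have := sub_eq_zero.1 (hz (-s) (by linarith))
    rw [← hcf, ← hcf, charFun_neg, charFun_neg] at this
    exact (starRingEnd ℂ).injective this

/-- Symmetrised law of the square root. -/
noncomputable def carlSym (μ : Measure ℝ) : Measure ℝ :=
  μ.map (fun x => Real.sqrt x) + μ.map (fun x => -Real.sqrt x)

lemma carl_sqrt_integrable (μ : Measure ℝ) (h0 : ∀ᵐ x ∂μ, 0 ≤ x) 
    (hi : ∀ n : ℕ, Integrable (fun x : ℝ => x ^ n) μ) (n : ℕ) :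
    Integrable (fun x => Real.sqrt x ^ n) μ := by
  refine ((hi 0).add (hi n)).mono' (Continuous.aestronglyMeasurable (by fun_prop)) ?_
  filter_upwards [h0] with x hx
  rw [Real.norm_of_nonneg (by positivity)]
  simp only [Pi.add_apply, pow_zero]
  rcases le_total x 1 with h | h
  · have : Real.sqrt x ^ n ≤ 1 := pow_le_one₀ (Real.sqrt_nonneg _) (Real.sqrt_le_one.2 h)
    have : 0 ≤ x ^ n := by positivity
    linarith
  · have : Real.sqrt x ^ n ≤ x ^ n := by
      gcongr
      rw [Real.sqrt_le_left hx]
      nlinarith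
    linarith

lemma carl_sym_integrable (μ : Measure ℝ) (f : ℝ → ℝ) (hf : Continuous f)
    (hi : Integrable (fun x => f (Real.sqrt x)) μ) (hi' : Integrable (fun x => f (-Real.sqrt x)) μ) :
    Integrable f (carlSym μ) ∧
      ∫ x, f x ∂(carlSym μ) = ∫ x, f (Real.sqrt x) ∂μ + ∫ x, f (-Real.sqrt x) ∂μ := by
  have m1 : AEMeasurable (fun x => Real.sqrt x) μ := Real.continuous_sqrt.measurable.aemeasurable
  have m2 : AEMeasurable (fun x => -Real.sqrt x) μ := Real.continuous_sqrt.neg.measurable.aemeasurable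
  have i1 : Integrable f (μ.map (fun x => Real.sqrt x)) :=
    (integrable_map_measure hf.aestronglyMeasurable m1).2 hi
  have i2 : Integrable f (μ.map (fun x => -Real.sqrt x)) :=
    (integrable_map_measure hf.aestronglyMeasurable m2).2 hi'
  refine ⟨i1.add_measure i2, ?_⟩
  unfold carlSym
  rw [integral_add_measure i1 i2, integral_map m1 hf.aestronglyMeasurable,
    integral_map m2 hf.aestronglyMeasurable]

lemma carl_sym_sq (μ : Measure ℝ) (h0 : ∀ᵐ x ∂μ, 0 ≤ x) :
    (carlSym μ).map (fun x => x ^ 2) = (2 : ENNReal) • μ := by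
  have m : Measurable (fun x : ℝ => x ^ 2) := by fun_prop
  unfold carlSym
  rw [Measure.map_add _ _ m, Measure.map_map m Real.continuous_sqrt.measurable,
    Measure.map_map m (show Measurable (fun x : ℝ => -Real.sqrt x) from Real.continuous_sqrt.neg.measurable), two_smul]
  congr 1
  · conv_rhs => rw [← Measure.map_id (μ := μ)]
    apply Measure.map_congr
    filter_upwards [h0] with x hx
    simp [Real.sq_sqrt hx]
  · conv_rhs => rw [← Measure.map_id (μ := μ)]
    apply Measure.map_congr
    filter_upwards [h0] with x hx
    simp [Real.sq_sqrt hx]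

/-- Stieltjes determinacy under Carleman's condition. -/
lemma carl_stieltjes (μ₁ μ₂ : Measure ℝ) [IsProbabilityMeasure μ₁] [IsProbabilityMeasure μ₂]
    (p₁ : ∀ᵐ x ∂μ₁, 0 ≤ x) (p₂ : ∀ᵐ x ∂μ₂, 0 ≤ x)
    (h₁ : ∀ n : ℕ, Integrable (fun x : ℝ => x ^ n) μ₁)
    (h₂ : ∀ n : ℕ, Integrable (fun x : ℝ => x ^ n) μ₂)
    (hm : ∀ n : ℕ, ∫ x, x ^ n ∂μ₁ = ∫ x, x ^ n ∂μ₂)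
    (hpos : ∀ n : ℕ, 0 < ∫ x, Real.sqrt x ^ n ∂μ₁)
    (hc : ¬ Summable (fun n : ℕ => (∫ x, x ^ (n+1) ∂μ₁) ^ (-(1 / (2 * ((n : ℝ) + 1)))))) :
    μ₁ = μ₂ := by
  have hfin : ∀ μ : Measure ℝ, IsProbabilityMeasure μ → IsFiniteMeasure (carlSym μ) := by
    intro μ _
    unfold carlSym
    infer_instance
  have := hfin μ₁ inferInstance
  have := hfin μ₂ inferInstance
  have habs : ∀ μ : Measure ℝ, (∀ᵐ x ∂μ, 0 ≤ x) → (∀ n : ℕ, Integrable (fun x : ℝ => x ^ n) μ) →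
      ∀ n : ℕ, Integrable (fun x : ℝ => |x| ^ n) (carlSym μ) ∧
        ∫ x, |x| ^ n ∂(carlSym μ) = 2 * ∫ x, Real.sqrt x ^ n ∂μ := by
    intro μ p hi n
    have hs := carl_sqrt_integrable μ p hi n
    have e : ∀ x, |Real.sqrt x| = Real.sqrt x := fun x => abs_of_nonneg (Real.sqrt_nonneg _)
    have := carl_sym_integrable μ (fun x => |x| ^ n) (by fun_prop) (by simpa [e] using hs)
      (by simpa [e] using hs)
    refine ⟨this.1, ?_⟩
    rw [this.2]
    simp [e, two_mul]
  have heven : ∀ μ : Measure ℝ, (∀ᵐ x ∂μ, 0 ≤ x) → ∀ n : ℕ,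
      ∫ x, Real.sqrt x ^ (2 * n) ∂μ = ∫ x, x ^ n ∂μ := by
    intro μ p n
    apply integral_congr_ae
    filter_upwards [p] with x hx
    rw [pow_mul, Real.sq_sqrt hx]
  have hmom : ∀ μ : Measure ℝ, (∀ᵐ x ∂μ, 0 ≤ x) → (∀ n : ℕ, Integrable (fun x : ℝ => x ^ n) μ) →
      ∀ n : ℕ, ∫ x, x ^ n ∂(carlSym μ) = if Even n then 2 * ∫ x, x ^ (n/2) ∂μ else 0 := by
    intro μ p hi n
    have hs := carl_sqrt_integrable μ p hi n
    have hs' : Integrable (fun x => (-Real.sqrt x) ^ n) μ := by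
      have : (fun x => (-Real.sqrt x) ^ n) = fun x => (-1) ^ n * Real.sqrt x ^ n := by
        ext x; rw [← mul_pow]; simp
      rw [this]; exact hs.const_mul _
    rw [(carl_sym_integrable μ (fun x => x ^ n) (by fun_prop) hs hs').2]
    split_ifs with h
    · obtain ⟨k, rfl⟩ := h
      have : (k + k) / 2 = k := by omega
      rw [this, ← heven μ p, two_mul, two_mul]
      congr 1
      congr 1
      ext x
      rw [Even.neg_pow ⟨k, rfl⟩]
    · have ho : Odd n := Nat.not_even_iff_odd.1 h
      simp_rw [ho.neg_pow]
      rw [integral_neg, add_neg_cancel]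
  set M : ℕ → ℝ := fun n => ∫ x, |x| ^ n ∂(carlSym μ₁) + ∫ x, |x| ^ n ∂(carlSym μ₂) with hM
  have hM2 : ∀ n, M (2 * n) = 4 * ∫ x, x ^ n ∂μ₁ := by
    intro n
    simp only [hM]
    rw [(habs μ₁ p₁ h₁ _).2, (habs μ₂ p₂ h₂ _).2, heven _ p₁, heven _ p₂, ← hm]
    ring
  have key : carlSym μ₁ = carlSym μ₂ := by
    refine carl_hamburger _ _ (fun n => (habs μ₁ p₁ h₁ n).1) (fun n => (habs μ₂ p₂ h₂ n).1) ?_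
      M (fun _ => rfl) ?_ ?_
    · intro n
      rw [hmom μ₁ p₁ h₁, hmom μ₂ p₂ h₂, hm]
    · intro n
      simp only [hM]
      rw [(habs μ₁ p₁ h₁ _).2, (habs μ₂ p₂ h₂ _).2]
      have : 0 ≤ ∫ x, Real.sqrt x ^ n ∂μ₂ := integral_nonneg fun x => by positivity
      have := hpos n
      linarith
    · intro hs
      apply hc
      have hinj : Function.Injective (fun p : ℕ => 2 * p + 1) := by
        intro a b h; simp at h; omega
      have := hs.comp_injective hinj
      refine this.congr (fun p => ?_)
      simp only [Function.comp_apply]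
      symm
      have e0 : M 0 = 4 := by
        have := hM2 0
        simpa using this
      have e1 : 2 * p + 1 + 1 = 2 * (p + 1) := by ring
      rw [e0, e1, hM2]
      have hp : 0 < ∫ x, x ^ (p+1) ∂μ₁ := by rw [← heven _ p₁]; exact hpos _
      have e2 : 4 / (4 * ∫ x, x ^ (p+1) ∂μ₁) = (∫ x, x ^ (p+1) ∂μ₁)⁻¹ := by
        field_simp
      rw [e2, Real.inv_rpow hp.le, Real.rpow_neg hp.le]
      congr 2
      push_cast
      rw [one_div]
      congr 1
      ring
  have := carl_sym_sq μ₁ p₁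
  rw [key, carl_sym_sq μ₂ p₂] at this
  ext t _
  have h := congrArg (fun m : Measure ℝ => m t) this
  simp only [Measure.smul_apply, smul_eq_mul] at h
  exact ((ENNReal.mul_right_inj (by norm_num) (by norm_num)).1 h).symm

lemma carl_setIntegral_pos (f : ℝ → ℝ) (b : ℝ) (hf : ∀ x, b < x → 0 < f x)
    (hi : IntegrableOn f (Set.Ioi b)) : 0 < ∫ x in Set.Ioi b, f x := by
  rw [setIntegral_pos_iff_support_of_nonneg_ae _ hi]
  · have : Set.Ioi b ⊆ Function.support f ∩ Set.Ioi b :=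
      fun x hx => ⟨(hf x hx).ne', hx⟩
    refine lt_of_lt_of_le ?_ (measure_mono this)
    simp
  · filter_upwards [ae_restrict_mem measurableSet_Ioi] with x hx
    exact (hf x hx).le

/-- Lemma 4: if Y has density g(x) = exp(-u(x) ln x) on (0,∞)
satisfying the Stieltjes Carleman condition, v ≥ u on [a,∞), and Y* has density
g*(x) = c*·exp(-v(x) ln x), then the moments of Y* are dominated (uniformly) by
those of Y, Y* satisfies Carleman's condition, and Y* is moment-determinate. -/
theorem stmt_18 (u v : ℝ → ℝ) (a c' : ℝ) (ha : 1 < a) (hc' : 0 < c')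
    (hv_meas : Measurable v)
    (hvu : ∀ x, a ≤ x → u x ≤ v x)
    -- g is a probability density on (0,∞) with all moments finite
    (hg_dens : ∫ x in Set.Ioi (0 : ℝ), Real.exp (-(u x * Real.log x)) = 1)
    (hg_int : IntegrableOn (fun x => Real.exp (-(u x * Real.log x))) (Set.Ioi 0))
    (hg_mom : ∀ n : ℕ, IntegrableOn
        (fun x => x ^ n * Real.exp (-(u x * Real.log x))) (Set.Ioi 0))
    -- Y satisfies the Stieltjes Carleman condition
    (hg_carleman : ¬ Summable (fun n : ℕ =>
        (∫ x in Set.Ioi (0 : ℝ), x ^ (n + 1) * Real.exp (-(u x * Real.log x)))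
          ^ (-(1 / (2 * ((n : ℝ) + 1))))))
    -- g* is a probability density on (0,∞) with all moments finite
    (hgs_dens : ∫ x in Set.Ioi (0 : ℝ), c' * Real.exp (-(v x * Real.log x)) = 1)
    (hgs_mom : ∀ n : ℕ, IntegrableOn
        (fun x => x ^ n * (c' * Real.exp (-(v x * Real.log x)))) (Set.Ioi 0)) :
    (∃ ctilde : ℝ, 0 < ctilde ∧ ∀ n : ℕ, 1 ≤ n →
        ∫ x in Set.Ioi (0 : ℝ), x ^ n * (c' * Real.exp (-(v x * Real.log x)))
          ≤ ctilde * ∫ x in Set.Ioi (0 : ℝ), x ^ n * Real.exp (-(u x * Real.log x))) ∧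
    (¬ Summable (fun n : ℕ =>
        (∫ x in Set.Ioi (0 : ℝ), x ^ (n + 1) * (c' * Real.exp (-(v x * Real.log x))))
          ^ (-(1 / (2 * ((n : ℝ) + 1)))))) ∧
    (∀ μ : Measure ℝ, IsProbabilityMeasure μ → μ (Set.Iio 0) = 0 →
        (∀ n : ℕ, ∫ x, x ^ n ∂μ
            = ∫ x in Set.Ioi (0 : ℝ), x ^ n * (c' * Real.exp (-(v x * Real.log x)))) →
        μ = (MeasureTheory.volume.restrict (Set.Ioi 0)).withDensity
              (fun x => ENNReal.ofReal (c' * Real.exp (-(v x * Real.log x))))) := by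
  
  set g : ℝ → ℝ := fun x => Real.exp (-(u x * Real.log x)) with hg
  set G : ℝ → ℝ := fun x => c' * Real.exp (-(v x * Real.log x)) with hG
  have gpos : ∀ x, 0 < g x := fun x => Real.exp_pos _
  have Gpos : ∀ x, 0 < G x := fun x => mul_pos hc' (Real.exp_pos _)
  have Gmeas : Measurable G := by
    simp only [hG]
    exact (Real.measurable_exp.comp (hv_meas.mul Real.measurable_log).neg).const_mul c'
  have Gle : ∀ x, a ≤ x → G x ≤ c' * g x := by
    intro x hx
    simp only [hG, hg]
    have := hvu x hx
    have : 0 ≤ Real.log x := Real.log_nonneg (by linarith)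
    gcongr
  have mpos : ∀ n : ℕ, 0 < ∫ x in Set.Ioi (0 : ℝ), x ^ n * g x := fun n =>
    carl_setIntegral_pos _ 0 (fun x hx => mul_pos (pow_pos hx n) (gpos x)) (hg_mom n)
  have bpos : ∀ n : ℕ, 0 < ∫ x in Set.Ioi (0 : ℝ), x ^ n * G x := fun n =>
    carl_setIntegral_pos _ 0 (fun x hx => mul_pos (pow_pos hx n) (Gpos x)) (hgs_mom n)
  have hsub : Set.Ioi a ⊆ Set.Ioi (0:ℝ) := Set.Ioi_subset_Ioi (by linarith)
  have capos : 0 < ∫ x in Set.Ioi a, g x :=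
    carl_setIntegral_pos _ a (fun x _ => gpos x) (hg_int.mono_set hsub)
  set ca := ∫ x in Set.Ioi a, g x with hca
  have a0 : 0 < a := by linarith
  have mlow : ∀ n : ℕ, ca * a ^ n ≤ ∫ x in Set.Ioi (0 : ℝ), x ^ n * g x := by
    intro n
    calc ca * a ^ n = ∫ x in Set.Ioi a, a ^ n * g x := by rw [integral_const_mul, mul_comm]
      _ ≤ ∫ x in Set.Ioi a, x ^ n * g x := by
          apply setIntegral_mono_on ((hg_int.mono_set hsub).const_mul _)
            ((hg_mom n).mono_set hsub) measurableSet_Ioi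
          intro x hx
          have := (gpos x).le
          have hx' : a ≤ x := le_of_lt hx
          gcongr
      _ ≤ _ := by
          apply setIntegral_mono_set (hg_mom n) _ hsub.eventuallyLE
          filter_upwards [ae_restrict_mem measurableSet_Ioi] with x hx
          exact mul_nonneg (pow_nonneg (le_of_lt hx) n) (gpos x).le
  have Gint : IntegrableOn G (Set.Ioi 0) := by simpa using hgs_mom 0
  have hbound : ∀ n : ℕ, ∫ x in Set.Ioi (0 : ℝ), x ^ n * G x
      ≤ (1 / ca + c') * ∫ x in Set.Ioi (0 : ℝ), x ^ n * g x := by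
    intro n
    have h1 : ∫ x in Set.Ioi (0 : ℝ), x ^ n * G x
        ≤ ∫ x in Set.Ioi (0 : ℝ), (a ^ n * G x + c' * (x ^ n * g x)) := by
      apply setIntegral_mono_on (hgs_mom n)
        ((Gint.const_mul _).add ((hg_mom n).const_mul _)) measurableSet_Ioi
      intro x hx
      change x ^ n * G x ≤ a ^ n * G x + c' * (x ^ n * g x)
      have hx0 : (0:ℝ) ≤ x := le_of_lt hx
      have hG0 := (Gpos x).le
      have hg0 := (gpos x).le
      rcases le_total a x with h | h
      · have h2 : x ^ n * G x ≤ x ^ n * (c' * g x) :=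
          mul_le_mul_of_nonneg_left (Gle x h) (by positivity)
        have h3 : 0 ≤ a ^ n * G x := by positivity
        linarith
      · have h2 : x ^ n * G x ≤ a ^ n * G x := by gcongr
        have h3 : 0 ≤ c' * (x ^ n * g x) := by positivity
        linarith
    have h4 : ∫ x in Set.Ioi (0 : ℝ), (a ^ n * G x + c' * (x ^ n * g x))
        = a ^ n + c' * ∫ x in Set.Ioi (0 : ℝ), x ^ n * g x := by
      rw [integral_add (Gint.const_mul _) ((hg_mom n).const_mul _), integral_const_mul (a ^ n) G,
        hgs_dens, mul_one, integral_const_mul c']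
    rw [h4] at h1
    have h2 : a ^ n ≤ 1 / ca * ∫ x in Set.Ioi (0 : ℝ), x ^ n * g x := by
      rw [one_div, inv_mul_eq_div, le_div_iff₀ capos, mul_comm]
      exact mlow n
    linarith
  have hcarl : ¬ Summable (fun n : ℕ =>
        (∫ x in Set.Ioi (0 : ℝ), x ^ (n + 1) * G x) ^ (-(1 / (2 * ((n : ℝ) + 1))))) := by
    intro hs
    apply hg_carleman
    set C := max 1 (1 / ca + c') with hC
    have hC1 : 1 ≤ C := le_max_left _ _
    refine Summable.of_nonneg_of_le (fun n => Real.rpow_nonneg (mpos _).le _) (fun n => ?_)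
      (hs.mul_left C)
    have hb := bpos (n+1)
    have hm := mpos (n+1)
    have hle : ∫ x in Set.Ioi (0 : ℝ), x ^ (n+1) * G x
        ≤ C * ∫ x in Set.Ioi (0 : ℝ), x ^ (n+1) * g x :=
      (hbound (n+1)).trans (mul_le_mul_of_nonneg_right (le_max_right _ _) hm.le)
    set p : ℝ := 1 / (2 * ((n : ℝ) + 1)) with hp
    have hp0 : 0 ≤ p := by positivity
    have hp1 : p ≤ 1 := by
      rw [hp, div_le_one (by positivity)]
      linarith [(Nat.cast_nonneg n : (0:ℝ) ≤ n)]
    rw [Real.rpow_neg hm.le, Real.rpow_neg hb.le]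
    have h1 : (∫ x in Set.Ioi (0 : ℝ), x ^ (n+1) * G x) ^ p
        ≤ C * (∫ x in Set.Ioi (0 : ℝ), x ^ (n+1) * g x) ^ p := by
      refine (Real.rpow_le_rpow hb.le hle hp0).trans ?_
      rw [Real.mul_rpow (by linarith) hm.le]
      apply mul_le_mul_of_nonneg_right _ (Real.rpow_nonneg hm.le _)
      simpa using Real.rpow_le_rpow_of_exponent_le hC1 hp1
    have q1 := Real.rpow_pos_of_pos hb p
    have q2 := Real.rpow_pos_of_pos hm p
    rw [← div_eq_mul_inv, inv_eq_one_div, div_le_div_iff₀ q2 q1]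
    linarith
  refine ⟨⟨1 / ca + c', by positivity, fun n _ => hbound n⟩, hcarl, ?_⟩
  intro μ hμ hμ0 hmu
  set μ' := (MeasureTheory.volume.restrict (Set.Ioi (0:ℝ))).withDensity
              (fun x => ENNReal.ofReal (G x)) with hμ'
  have Gm : Measurable (fun x => ENNReal.ofReal (G x)) := ENNReal.measurable_ofReal.comp Gmeas
  have muInt : ∀ f : ℝ → ℝ, ∫ x, f x ∂μ' = ∫ x in Set.Ioi (0:ℝ), f x * G x := by
    intro f
    rw [hμ', integral_withDensity_eq_integral_toReal_smul Gm (by simp)]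
    congr 1
    ext x
    rw [ENNReal.toReal_ofReal (Gpos x).le, smul_eq_mul, mul_comm]
  have muIble : ∀ f : ℝ → ℝ, Integrable f μ' ↔ IntegrableOn (fun x => f x * G x) (Set.Ioi 0) := by
    intro f
    rw [hμ', integrable_withDensity_iff Gm (by simp)]
    unfold IntegrableOn
    apply integrable_congr
    refine ae_of_all _ fun x => ?_
    simp only
    rw [ENNReal.toReal_ofReal (Gpos x).le]
  have hprob : IsProbabilityMeasure μ' := by
    constructor
    rw [hμ', withDensity_apply _ MeasurableSet.univ, Measure.restrict_univ,
      ← ofReal_integral_eq_lintegral_ofReal Gint (ae_of_all _ fun x => (Gpos x).le), hgs_dens,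
      ENNReal.ofReal_one]
  have p' : ∀ᵐ x ∂μ', 0 ≤ x := by
    have : ∀ᵐ x ∂(MeasureTheory.volume.restrict (Set.Ioi (0:ℝ))), 0 ≤ x := by
      filter_upwards [ae_restrict_mem measurableSet_Ioi] with x hx
      exact le_of_lt hx
    exact (withDensity_absolutelyContinuous _ _).ae_le this
  have p : ∀ᵐ x ∂μ, 0 ≤ x := by
    rw [ae_iff]
    convert hμ0 using 2
    ext x
    simp
  have hi' : ∀ n : ℕ, Integrable (fun x : ℝ => x ^ n) μ' := fun n => (muIble _).2 (hgs_mom n)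
  symm
  refine carl_stieltjes μ' μ p' p hi' ?_ ?_ ?_ ?_
  · intro n
    by_contra h
    have h1 := hmu n
    rw [integral_undef h] at h1
    exact (bpos n).ne h1
  · intro n
    rw [muInt, hmu]
  · intro n
    rw [muInt]
    exact carl_setIntegral_pos _ 0
      (fun x hx => mul_pos (pow_pos (Real.sqrt_pos.2 hx) n) (Gpos x))
      ((muIble _).1 (carl_sqrt_integrable μ' p' hi' n))
  · simp_rw [muInt]
    exact hcarl
end
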